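/- Let {m(n)}_{n≥1} be positive integers with |m(n) − n| = o(n) as n → ∞. Assume there exists β > 0 such that φ(n) ≤ β^{−1}e^{−βn} for all n ≥ 1, and assume the finite entropy condition −Σ_{a∈𝒜} P([a]) ln P([a]) < ∞. Then for P×P-almost every (ξ, η) ∈ Ω × Ω, lim_{n→∞} d_TV( ℒ(Σ^{ξ,η}_{n,m(n)}), Geo( P(A^η_{m(n)}) / (P(A^η_{m(n)}) + P(A^ξ_n)) ) ) = 0. In particular, if P(A^ξ_n)/P(A^η_{m(n)}) → λ as n → ∞, then the law of Σ^{ξ,η}_{n,m(n)} converges in total variation to the geometric distribution with parameter (1+λ)^{−1}. -/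

import Mathlib

open MeasureTheory Filter Set

/-- Total variation distance `d_TV(μ,ν) = sup_G |μ(G) − ν(G)|`. -/
noncomputable def dTV {α : Type*} [MeasurableSpace α] (μ ν : Measure α) : ℝ :=
  sSup {x | ∃ s : Set α, MeasurableSet s ∧ x = |(μ s).toReal - (ν s).toReal|}

/-- Geometric distribution on ℕ with `Geo(ρ){k} = ρ(1−ρ)^k`. -/
noncomputable def geoMeasure (ρ : ℝ) : Measure ℕ :=
  Measure.sum fun k => ENNReal.ofReal (ρ * (1 - ρ) ^ k) • Measure.dirac k

/-- First hitting time `τ_V(ω) = min{k ≥ 1 : T^k ω ∈ V}` (junk value 0 if no such k). -/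
noncomputable def hitTime {Ω : Type*} (T : Ω → Ω) (V : Set Ω) (ω : Ω) : ℕ :=
  sInf {k | 1 ≤ k ∧ T^[k] ω ∈ V}

/-- `Σ_{U,V} = Σ_{k=0}^{τ_V−1} 1_U ∘ T^k`. -/
noncomputable def numVisits {Ω : Type*} (T : Ω → Ω) (U V : Set Ω) (ω : Ω) : ℕ :=
  ∑ k ∈ Finset.range (hitTime T V ω), U.indicator (fun _ => 1) (T^[k] ω)

/-- The φ-dependence coefficient between two sub-σ-algebras. -/
noncomputable def phiCoef {Ω : Type*} [MeasurableSpace Ω] (P : Measure Ω)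
    (G H : MeasurableSpace Ω) : ℝ :=
  sSup {x | ∃ Γ Δ : Set Ω, MeasurableSet[G] Γ ∧ MeasurableSet[H] Δ ∧ P Γ ≠ 0 ∧
    x = |(P (Γ ∩ Δ)).toReal / (P Γ).toReal - (P Δ).toReal|}

/-- σ-algebra on the sequence space generated by the coordinates in `s`. -/
noncomputable def coordAlg (𝓐 : Type*) [m𝓐 : MeasurableSpace 𝓐] (s : Set ℕ) :
    MeasurableSpace (ℕ → 𝓐) :=
  ⨆ i ∈ s, m𝓐.comap fun ω => ω i

/-- `φ(n) = sup_{m≥0} φ(ℱ_{0,m}, ℱ_{m+n,∞})`. -/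
noncomputable def phiMix (𝓐 : Type*) [MeasurableSpace 𝓐] (P : Measure (ℕ → 𝓐)) (n : ℕ) : ℝ :=
  ⨆ m : ℕ, phiCoef P (coordAlg 𝓐 (Set.Iic m)) (coordAlg 𝓐 (Set.Ici (m + n)))

/-- `φ` extended to ℤ by `φ(k) = 1` for `k ≤ 0`. -/
noncomputable def phiMixZ (𝓐 : Type*) [MeasurableSpace 𝓐] (P : Measure (ℕ → 𝓐)) (j : ℤ) : ℝ :=
  if j ≤ 0 then 1 else phiMix 𝓐 P j.toNat

/-- The left shift on `𝓐^ℕ`. -/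
def shift (𝓐 : Type*) : (ℕ → 𝓐) → (ℕ → 𝓐) := fun ω n => ω (n + 1)

/-- `π(U) = min{1 ≤ k ≤ n : U ∩ T^{−k}U ≠ ∅}`. -/
noncomputable def piRet {Ω : Type*} (T : Ω → Ω) (n : ℕ) (U : Set Ω) : ℕ :=
  sInf {k | 1 ≤ k ∧ k ≤ n ∧ (U ∩ T^[k] ⁻¹' U).Nonempty}

/-- `π(U,V) = min{0 ≤ k ≤ min(n,m) : U ∩ T^{−k}V ≠ ∅ or V ∩ T^{−k}U ≠ ∅}`. -/
noncomputable def piJoint {Ω : Type*} (T : Ω → Ω) (n m : ℕ) (U V : Set Ω) : ℕ :=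
  sInf {k | k ≤ min n m ∧ ((U ∩ T^[k] ⁻¹' V).Nonempty ∨ (V ∩ T^[k] ⁻¹' U).Nonempty)}

/-- `κ_{U,V} = min(π(U,V), π(U), π(V))`. -/
noncomputable def kappa {Ω : Type*} (T : Ω → Ω) (n m : ℕ) (U V : Set Ω) : ℕ :=
  min (piJoint T n m U V) (min (piRet T n U) (piRet T m V))


/-- The cylinder `A^ξ_n = [ξ_0 … ξ_{n−1}]`. -/
def cyl {𝓐 : Type*} (ξ : ℕ → 𝓐) (n : ℕ) : Set (ℕ → 𝓐) := {ω | ∀ i < n, ω i = ξ i}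


/-! ### Total variation on ℕ -/

lemma dTV_bdd {α : Type*} [MeasurableSpace α] (μ ν : Measure α)
    [IsProbabilityMeasure μ] [IsProbabilityMeasure ν] :
    BddAbove {x | ∃ s : Set α, MeasurableSet s ∧ x = |(μ s).toReal - (ν s).toReal|} := by
  refine ⟨1, ?_⟩
  rintro x ⟨s, -, rfl⟩
  have h1 : μ.real s ≤ 1 := measureReal_le_one
  have h2 : ν.real s ≤ 1 := measureReal_le_one
  have h3 : 0 ≤ μ.real s := measureReal_nonneg
  have h4 : 0 ≤ ν.real s := measureReal_nonneg
  change |μ.real s - ν.real s| ≤ 1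
  rw [abs_le]; constructor <;> linarith

lemma dTV_nonneg {α : Type*} [MeasurableSpace α] (μ ν : Measure α) : 0 ≤ dTV μ ν := by
  apply Real.sSup_nonneg
  rintro x ⟨s, -, rfl⟩
  exact abs_nonneg _

lemma dTV_triangle {α : Type*} [MeasurableSpace α] (μ κ ν : Measure α)
    [IsProbabilityMeasure μ] [IsProbabilityMeasure ν] [IsProbabilityMeasure κ] :
    dTV μ ν ≤ dTV μ κ + dTV κ ν := by
  refine csSup_le ⟨_, ⟨∅, MeasurableSet.empty, rfl⟩⟩ ?_
  rintro x ⟨s, hs, rfl⟩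
  have h1 := le_csSup (dTV_bdd μ κ) ⟨s, hs, rfl⟩
  have h2 := le_csSup (dTV_bdd κ ν) ⟨s, hs, rfl⟩
  have := abs_sub_le (μ s).toReal (κ s).toReal (ν s).toReal
  unfold dTV
  linarith

lemma hasSum_real_nat (μ : Measure ℕ) [IsFiniteMeasure μ] (s : Set ℕ) :
    HasSum (fun k => s.indicator (fun k => μ.real {k}) k) (μ.real s) := by
  have h := Measure.tsum_indicator_apply_singleton μ s (MeasurableSet.of_discrete)
  have hne : (∑' k, s.indicator (fun k => μ {k}) k) ≠ ⊤ := by rw [h]; finiteness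
  have := ENNReal.hasSum_toReal hne
  rw [← ENNReal.tsum_toReal_eq (fun k => ENNReal.ne_top_of_tsum_ne_top hne k), h] at this
  convert this using 1
  · ext k
    by_cases hk : k ∈ s <;> simp [hk, Measure.real]
  · rfl

lemma dTV_le_of_sum (μ ν : Measure ℕ) [IsFiniteMeasure μ] [IsFiniteMeasure ν] (ε : ℝ)
    (h : ∀ K, ∑ k ∈ Finset.range K, |μ.real {k} - ν.real {k}| ≤ ε) : dTV μ ν ≤ ε := by
  refine csSup_le ⟨_, ⟨∅, MeasurableSet.empty, rfl⟩⟩ ?_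
  rintro x ⟨s, hs, rfl⟩
  have h1 := (hasSum_real_nat μ s).sub (hasSum_real_nat ν s)
  have h2 := (h1.tendsto_sum_nat).abs
  refine le_of_tendsto h2 (Eventually.of_forall fun K => ?_)
  refine (Finset.abs_sum_le_sum_abs _ _).trans (le_trans (Finset.sum_le_sum fun k _ => ?_) (h K))
  by_cases hk : k ∈ s <;> simp [hk]

lemma geo_seq_bound (d S : ℕ → ℝ) (ρ : ℝ) (h0 : 0 ≤ ρ) (h1 : ρ ≤ 1) (hS0 : S 0 = 1)
    (hS : ∀ k, S (k + 1) = S k - d k) (K : ℕ) :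
    ∑ k ∈ Finset.range K, |d k - ρ * (1 - ρ) ^ k| ≤
      2 * ∑ k ∈ Finset.range K, |d k - ρ * S k| := by
  have key : ∀ K, ρ * ∑ k ∈ Finset.range K, |S k - (1 - ρ) ^ k| + |S K - (1 - ρ) ^ K| ≤
      ∑ k ∈ Finset.range K, |d k - ρ * S k| := by
    intro K
    induction K with
    | zero => simp [hS0]
    | succ K ih =>
      rw [Finset.sum_range_succ, Finset.sum_range_succ]
      have : |S (K + 1) - (1 - ρ) ^ (K + 1)| ≤
          (1 - ρ) * |S K - (1 - ρ) ^ K| + |d K - ρ * S K| := by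
        have e : S (K + 1) - (1 - ρ) ^ (K + 1) =
          (1 - ρ) * (S K - (1 - ρ) ^ K) - (d K - ρ * S K) := by rw [hS]; ring
        rw [e]
        refine (abs_sub _ _).trans ?_
        rw [abs_mul, abs_of_nonneg (by linarith : 0 ≤ 1 - ρ)]
      nlinarith
  have h2 : ∑ k ∈ Finset.range K, |d k - ρ * (1 - ρ) ^ k| ≤
      ∑ k ∈ Finset.range K, (|d k - ρ * S k| + ρ * |S k - (1 - ρ) ^ k|) := by
    refine Finset.sum_le_sum fun k _ => ?_
    have e : d k - ρ * (1 - ρ) ^ k = (d k - ρ * S k) + ρ * (S k - (1 - ρ) ^ k) := by ring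
    rw [e]
    refine (abs_add_le _ _).trans ?_
    rw [abs_mul, abs_of_nonneg h0]
  rw [Finset.sum_add_distrib, ← Finset.mul_sum] at h2
  have := key K
  have h3 : 0 ≤ |S K - (1 - ρ) ^ K| := abs_nonneg _
  linarith

lemma geo_singleton (ρ : ℝ) (k : ℕ) :
    geoMeasure ρ {k} = ENNReal.ofReal (ρ * (1 - ρ) ^ k) := by
  unfold geoMeasure
  rw [Measure.sum_apply _ (MeasurableSet.singleton k), tsum_eq_single k]
  · simp
  · intro b hb
    simp [hb]

lemma geo_prob (ρ : ℝ) (h0 : 0 < ρ) (h1 : ρ ≤ 1) : IsProbabilityMeasure (geoMeasure ρ) := by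
  constructor
  have := Measure.tsum_indicator_apply_singleton (geoMeasure ρ) univ MeasurableSet.univ
  rw [← this]
  simp only [indicator_univ, geo_singleton]
  have hs := (hasSum_geometric_of_lt_one (by linarith : 0 ≤ 1 - ρ) (by linarith)).mul_left ρ
  rw [← ENNReal.ofReal_tsum_of_nonneg _ hs.summable, hs.tsum_eq]
  · simp [h0.ne']
  · intro k
    have : 0 ≤ 1 - ρ := by linarith
    positivity

lemma geo_real (ρ : ℝ) (h0 : 0 < ρ) (h1 : ρ ≤ 1) (k : ℕ) :
    (geoMeasure ρ).real {k} = ρ * (1 - ρ) ^ k := by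
  rw [Measure.real, geo_singleton, ENNReal.toReal_ofReal]
  have : 0 ≤ 1 - ρ := by linarith
  positivity

lemma dTV_geo_le (μ : Measure ℕ) [IsProbabilityMeasure μ] (ρ ε : ℝ) (h0 : 0 < ρ) (h1 : ρ ≤ 1)
    (h : ∀ K, ∑ k ∈ Finset.range K, |μ.real {k} - ρ * μ.real (Ici k)| ≤ ε) :
    dTV μ (geoMeasure ρ) ≤ 2 * ε := by
  have := geo_prob ρ h0 h1
  apply dTV_le_of_sum
  intro K
  simp only [geo_real ρ h0 h1]
  refine (geo_seq_bound (fun k => μ.real {k}) (fun k => μ.real (Ici k)) ρ h0.le h1 ?_ ?_ K).trans ?_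
  · simp
  · intro k
    have e : Ici k = {k} ∪ Ici (k + 1) := by ext x; simp; omega
    have : μ.real (Ici k) = μ.real {k} + μ.real (Ici (k + 1)) := by
      rw [e, measureReal_union _ (MeasurableSet.of_discrete)]
      simp
    change μ.real (Ici (k + 1)) = μ.real (Ici k) - μ.real {k}
    linarith
  · linarith [h K]

lemma dTV_geo_geo (ρ ρ' : ℝ) (h0 : 0 < ρ) (h1 : ρ ≤ 1) (h0' : 0 < ρ') (h1' : ρ' ≤ 1) :
    dTV (geoMeasure ρ') (geoMeasure ρ) ≤ 2 * (|ρ' - ρ| / ρ') := by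
  have := geo_prob ρ h0 h1
  have := geo_prob ρ' h0' h1'
  apply dTV_le_of_sum
  intro K
  simp only [geo_real ρ h0 h1, geo_real ρ' h0' h1']
  have h2 : 0 ≤ 1 - ρ' := by linarith
  refine (geo_seq_bound (fun k => ρ' * (1 - ρ') ^ k) (fun k => (1 - ρ') ^ k) ρ h0.le h1
    (by simp) (fun k => by ring) K).trans ?_
  gcongr
  have e : ∀ k, |ρ' * (1 - ρ') ^ k - ρ * (1 - ρ') ^ k| = |ρ' - ρ| * (1 - ρ') ^ k := by
    intro k
    rw [← sub_mul, abs_mul, abs_of_nonneg (pow_nonneg h2 k)]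
  simp only [e]
  rw [← Finset.mul_sum, div_eq_mul_inv]
  gcongr
  have hs := hasSum_geometric_of_lt_one h2 (by linarith)
  have := sum_le_hasSum (Finset.range K) (fun k _ => pow_nonneg h2 k) hs
  simpa using this


/-! ### Deterministic estimate -/

/-- number of visits to `U` in times `[0,t)` -/
noncomputable def cnt {Ω : Type*} (T : Ω → Ω) (U : Set Ω) (t : ℕ) (ω : Ω) : ℕ :=
  ∑ k ∈ Finset.range t, U.indicator (fun _ => 1) (T^[k] ω)

/-- no visit to `V` in times `[1,t)` -/
def noV {Ω : Type*} (T : Ω → Ω) (V : Set Ω) (t : ℕ) : Set Ω :=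
  {ω | ∀ i, 1 ≤ i → i < t → T^[i] ω ∉ V}

/-- exactly `k` visits to `U` in `[0,t)` and no visit to `V` in `[1,t)` -/
def Cset {Ω : Type*} (T : Ω → Ω) (U V : Set Ω) (k t : ℕ) : Set Ω :=
  {ω | cnt T U t ω = k} ∩ noV T V t

/-- some visit to `W` in times `[a,b)` -/
def visW {Ω : Type*} (T : Ω → Ω) (W : Set Ω) (a b : ℕ) : Set Ω :=
  ⋃ i ∈ Finset.Ico a b, T^[i] ⁻¹' W

section det
variable {Ω : Type*}

lemma cnt_succ (T : Ω → Ω) (U : Set Ω) (t : ℕ) (ω : Ω) :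
    cnt T U (t + 1) ω = cnt T U t ω + U.indicator (fun _ => 1) (T^[t] ω) := by
  simp [cnt, Finset.sum_range_succ]

lemma cnt_mono (T : Ω → Ω) (U : Set Ω) (ω : Ω) : Monotone (fun t => cnt T U t ω) := by
  apply monotone_nat_of_le_succ
  intro t
  rw [cnt_succ]; omega

lemma noV_anti (T : Ω → Ω) (V : Set Ω) : Antitone (noV T V) := by
  intro s t hst ω h i h1 h2
  exact h i h1 (h2.trans_le hst)

lemma measurable_cnt (m0 : MeasurableSpace Ω) (T : Ω → Ω) (U : Set Ω) (t : ℕ)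
    (h : ∀ i < t, MeasurableSet[m0] (T^[i] ⁻¹' U)) : Measurable[m0] (cnt T U t) := by
  unfold cnt
  refine Finset.measurable_sum _ fun i hi => ?_
  have : (fun ω => U.indicator (fun _ => 1) (T^[i] ω) : Ω → ℕ)
      = (T^[i] ⁻¹' U).indicator (fun _ => 1) := by
    ext ω
    by_cases hω : T^[i] ω ∈ U
    · rw [indicator_of_mem hω, indicator_of_mem (show ω ∈ T^[i] ⁻¹' U from hω)]
    · rw [indicator_of_notMem hω, indicator_of_notMem (show ω ∉ T^[i] ⁻¹' U from hω)]
  rw [this]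
  exact measurable_const.indicator (h i (Finset.mem_range.1 hi))

lemma measurableSet_noV (m0 : MeasurableSpace Ω) (T : Ω → Ω) (V : Set Ω) (t : ℕ)
    (h : ∀ i < t, MeasurableSet[m0] (T^[i] ⁻¹' V)) : MeasurableSet[m0] (noV T V t) := by
  have : noV T V t = ⋂ i, ⋂ (_ : 1 ≤ i), ⋂ (_ : i < t), (T^[i] ⁻¹' V)ᶜ := by
    ext ω; simp [noV]
  rw [this]
  exact MeasurableSet.iInter fun i => MeasurableSet.iInter fun _ => MeasurableSet.iInter fun hi =>
    (h i hi).compl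

lemma measurableSet_Cset (m0 : MeasurableSpace Ω) (T : Ω → Ω) (U V : Set Ω) (k t : ℕ)
    (hU : ∀ i < t, MeasurableSet[m0] (T^[i] ⁻¹' U))
    (hV : ∀ i < t, MeasurableSet[m0] (T^[i] ⁻¹' V)) : MeasurableSet[m0] (Cset T U V k t) :=
  (measurable_cnt m0 T U t hU (MeasurableSet.singleton k)).inter (measurableSet_noV m0 T V t hV)

lemma measurableSet_visW (m0 : MeasurableSpace Ω) (T : Ω → Ω) (W : Set Ω) (a b : ℕ)
    (h : ∀ i, a ≤ i → MeasurableSet[m0] (T^[i] ⁻¹' W)) : MeasurableSet[m0] (visW T W a b) :=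
  Finset.measurableSet_biUnion _ fun i hi => h i (Finset.mem_Ico.1 hi).1

/-- Off the event of visiting `W`, the counts do not change. -/
lemma Cset_diff_eq (T : Ω → Ω) (U V : Set Ω) (k : ℕ) {a b : ℕ} (hab : a ≤ b) :
    Cset T U V k b \ visW T (U ∪ V) a b = Cset T U V k a \ visW T (U ∪ V) a b := by
  ext ω
  simp only [Set.mem_sdiff, and_congr_left_iff]
  intro hω
  have h : ∀ i, a ≤ i → i < b → T^[i] ω ∉ U ∧ T^[i] ω ∉ V := by
    intro i h1 h2
    by_contra hc
    apply hω
    simp only [visW, mem_iUnion, Finset.mem_Ico]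
    refine ⟨i, ⟨h1, h2⟩, ?_⟩
    simp only [mem_preimage, mem_union]
    tauto
  have hc : cnt T U b ω = cnt T U a ω := by
    unfold cnt
    rw [← Finset.sum_range_add_sum_Ico _ hab]
    simp only [Nat.add_eq_left]
    refine Finset.sum_eq_zero fun i hi => ?_
    rw [Finset.mem_Ico] at hi
    simp [(h i hi.1 hi.2).1]
  have hn : ω ∈ noV T V b ↔ ω ∈ noV T V a := by
    refine ⟨fun h' => noV_anti T V hab h', fun h' i h1 h2 => ?_⟩
    by_cases hi : i < a
    · exact h' i h1 hi
    · exact (h i (not_lt.1 hi) h2).2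
  simp only [Cset, mem_inter_iff, mem_ofPred_eq, hc, hn]

variable [MeasurableSpace Ω] (P : Measure Ω) [IsProbabilityMeasure P]

lemma sum_Cset_le (T : Ω → Ω) (hT : Measurable T) (U V : Set Ω) (hU : MeasurableSet U)
    (hV : MeasurableSet V) (t K : ℕ) (A : Set Ω) (hA : MeasurableSet A) :
    ∑ k ∈ Finset.range K, P.real (Cset T U V k t ∩ A) ≤ P.real (noV T V t ∩ A) := by
  rw [← measureReal_biUnion_finset]
  · refine measureReal_mono ?_
    intro ω hω
    simp only [mem_iUnion] at hω
    obtain ⟨k, _, h1, h2⟩ := hω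
    exact ⟨h1.2, h2⟩
  · intro i _ j _ hij
    rw [Function.onFun, Set.disjoint_left]
    rintro ω ⟨⟨h1, _⟩, _⟩ ⟨⟨h2, _⟩, _⟩
    exact hij (h1.symm.trans h2)
  · intro k _
    exact (measurableSet_Cset _ T U V k t (fun i _ => hT.iterate i hU)
      (fun i _ => hT.iterate i hV)).inter hA

/-- change of the counting sets between times `a` and `b` -/
lemma sum_Cset_diff (T : Ω → Ω) (hT : Measurable T) (U V : Set Ω) (hU : MeasurableSet U)
    (hV : MeasurableSet V) (s a b K : ℕ) (hsa : s ≤ a) (hab : a ≤ b)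
    (A : Set Ω) (hA : MeasurableSet A) :
    ∑ k ∈ Finset.range K, |P.real (Cset T U V k b ∩ A) - P.real (Cset T U V k a ∩ A)| ≤
      2 * P.real (noV T V s ∩ (visW T (U ∪ V) a b ∩ A)) := by
  set H := visW T (U ∪ V) a b with hH
  have hHm : MeasurableSet H :=
    measurableSet_visW _ _ _ _ _ fun i _ => hT.iterate i (hU.union hV)
  have e : ∀ k, |P.real (Cset T U V k b ∩ A) - P.real (Cset T U V k a ∩ A)| ≤
      P.real (Cset T U V k b ∩ (H ∩ A)) + P.real (Cset T U V k a ∩ (H ∩ A)) := by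
    intro k
    have h1 := measureReal_inter_add_sdiff (μ := P) (s := Cset T U V k b ∩ A) hHm
    have h2 := measureReal_inter_add_sdiff (μ := P) (s := Cset T U V k a ∩ A) hHm
    have h3 : (Cset T U V k b ∩ A) \ H = (Cset T U V k a ∩ A) \ H := by
      have := Cset_diff_eq T U V k hab
      rw [← hH] at this
      ext ω
      have h5 := Set.ext_iff.1 this ω
      simp only [Set.mem_sdiff, mem_inter_iff] at h5 ⊢
      tauto
    have h4 : ∀ t, Cset T U V k t ∩ A ∩ H = Cset T U V k t ∩ (H ∩ A) := by
      intro t; ext; simp; tauto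
    rw [h3, h4] at h1
    rw [h4] at h2
    have h5 : 0 ≤ P.real (Cset T U V k b ∩ (H ∩ A)) := measureReal_nonneg
    have h6 : 0 ≤ P.real (Cset T U V k a ∩ (H ∩ A)) := measureReal_nonneg
    rw [abs_le]; constructor <;> linarith
  refine (Finset.sum_le_sum fun k _ => e k).trans ?_
  rw [Finset.sum_add_distrib, two_mul]
  have h1 := sum_Cset_le P T hT U V hU hV b K _ (hHm.inter hA)
  have h2 := sum_Cset_le P T hT U V hU hV a K _ (hHm.inter hA)
  have h3 : P.real (noV T V b ∩ (H ∩ A)) ≤ P.real (noV T V s ∩ (H ∩ A)) :=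
    measureReal_mono (inter_subset_inter_left _ (noV_anti T V (hsa.trans hab)))
  have h4 : P.real (noV T V a ∩ (H ∩ A)) ≤ P.real (noV T V s ∩ (H ∩ A)) :=
    measureReal_mono (inter_subset_inter_left _ (noV_anti T V hsa))
  linarith

/-- The per-time decoupling bound. -/
lemma F_bound (T : Ω → Ω) (hT : MeasurePreserving T P P) (U V D : Set Ω) (hU : MeasurableSet U)
    (hV : MeasurableSet V) (hD : MeasurableSet D)
    (F G : ℕ → MeasurableSpace Ω)
    (hFU : ∀ i t, i < t → MeasurableSet[F t] (T^[i] ⁻¹' U))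
    (hFV : ∀ i t, i < t → MeasurableSet[F t] (T^[i] ⁻¹' V))
    (hGU : ∀ i t, t ≤ i → MeasurableSet[G t] (T^[i] ⁻¹' U))
    (hGV : ∀ i t, t ≤ i → MeasurableSet[G t] (T^[i] ⁻¹' V))
    (hGD : ∀ i t, t ≤ i → MeasurableSet[G t] (T^[i] ⁻¹' D))
    (g : ℕ) (φ : ℝ) (hφ : 0 ≤ φ)
    (hmix : ∀ s Γ Δ, MeasurableSet[F s] Γ → MeasurableSet[G (s + g)] Δ →
      |P.real (Γ ∩ Δ) - P.real Γ * P.real Δ| ≤ φ * P.real Γ)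
    (r : ℝ) (hr : ∀ j, 1 ≤ j → j ≤ g → P.real ((U ∪ V) ∩ T^[j] ⁻¹' D) ≤ r)
    (s K : ℕ) :
    ∑ k ∈ Finset.range K, |P.real (Cset T U V k (s + 2 * g) ∩ T^[s + 2 * g] ⁻¹' D)
        - P.real D * P.real (Cset T U V k (s + 2 * g))| ≤
      P.real (noV T V s) * (2 * (g * r + φ) + φ + 2 * P.real D * (g * P.real (U ∪ V) + φ)) := by
  set t := s + 2 * g with ht
  set H := visW T (U ∪ V) (s + g) t with hH
  set Dt := T^[t] ⁻¹' D with hDt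
  have hDtm : MeasurableSet Dt := hT.measurable.iterate t hD
  have hPD : P.real Dt = P.real D := (hT.iterate t).measureReal_preimage hD.nullMeasurableSet
  have hQ : 0 ≤ P.real (noV T V s) := measureReal_nonneg
  have hD0 : 0 ≤ P.real D := measureReal_nonneg
  have hGH : MeasurableSet[G (s + g)] H :=
    measurableSet_visW _ _ _ _ _ fun i hi => (hGU i _ hi).union (hGV i _ hi)
  have hnF : MeasurableSet[F s] (noV T V s) := measurableSet_noV _ _ _ _ fun i hi => hFV i s hi
  -- first term
  have b1 := sum_Cset_diff P T hT.measurable U V hU hV s (s + g) t K (by omega) (by omega) Dt hDtm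
  rw [← hH] at b1
  have b1' : P.real (noV T V s ∩ (H ∩ Dt)) ≤ P.real (noV T V s) * (g * r + φ) := by
    have h1 := (abs_le.1 (hmix s _ (H ∩ Dt) hnF (hGH.inter (hGD t _ (by omega))))).2
    have h2 : P.real (H ∩ Dt) ≤ g * r := by
      have : H ∩ Dt = ⋃ i ∈ Finset.Ico (s + g) t, (T^[i] ⁻¹' (U ∪ V) ∩ Dt) := by
        rw [hH, visW, iUnion₂_inter]
      rw [this]
      refine (measureReal_biUnion_finset_le _ _).trans ?_
      have h3 : ∀ i ∈ Finset.Ico (s + g) t, P.real (T^[i] ⁻¹' (U ∪ V) ∩ Dt) ≤ r := by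
        intro i hi
        rw [Finset.mem_Ico] at hi
        have e : T^[i] ⁻¹' (U ∪ V) ∩ Dt = T^[i] ⁻¹' ((U ∪ V) ∩ T^[t - i] ⁻¹' D) := by
          rw [preimage_inter, ← preimage_comp, ← Function.iterate_add,
            show t - i + i = t by omega]
        rw [e, (hT.iterate i).measureReal_preimage
          ((hU.union hV).inter (hT.measurable.iterate _ hD)).nullMeasurableSet]
        exact hr _ (by omega) (by omega)
      refine (Finset.sum_le_card_nsmul _ _ _ h3).trans (le_of_eq ?_)
      rw [Nat.card_Ico, nsmul_eq_mul, show t - (s + g) = g by omega]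
    nlinarith
  -- third term
  have b3 := sum_Cset_diff P T hT.measurable U V hU hV s (s + g) t K (by omega) (by omega) univ
    MeasurableSet.univ
  rw [← hH] at b3
  simp only [inter_univ] at b3
  have b3' : P.real (noV T V s ∩ H) ≤ P.real (noV T V s) * (g * P.real (U ∪ V) + φ) := by
    have h1 := (abs_le.1 (hmix s _ H hnF hGH)).2
    have h2 : P.real H ≤ g * P.real (U ∪ V) := by
      rw [hH, visW]
      refine (measureReal_biUnion_finset_le _ _).trans ?_
      have h3 : ∀ i ∈ Finset.Ico (s + g) t, P.real (T^[i] ⁻¹' (U ∪ V)) ≤ P.real (U ∪ V) := by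
        intro i hi
        rw [(hT.iterate i).measureReal_preimage (hU.union hV).nullMeasurableSet]
      refine (Finset.sum_le_card_nsmul _ _ _ h3).trans (le_of_eq ?_)
      rw [Nat.card_Ico, nsmul_eq_mul, show t - (s + g) = g by omega]
    nlinarith
  -- second term
  have b2 : ∑ k ∈ Finset.range K, |P.real (Cset T U V k (s + g) ∩ Dt)
      - P.real D * P.real (Cset T U V k (s + g))| ≤ φ * P.real (noV T V s) := by
    have h1 : ∀ k ∈ Finset.range K, |P.real (Cset T U V k (s + g) ∩ Dt)
      - P.real D * P.real (Cset T U V k (s + g))| ≤ φ * P.real (Cset T U V k (s + g) ∩ univ) := by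
      intro k _
      have := hmix (s + g) (Cset T U V k (s + g)) Dt
        (measurableSet_Cset _ _ _ _ _ _ (fun i hi => hFU i _ hi) (fun i hi => hFV i _ hi))
        (hGD t _ (by omega))
      rw [hPD] at this
      rw [inter_univ, mul_comm (P.real D)]
      exact this
    refine (Finset.sum_le_sum h1).trans ?_
    rw [← Finset.mul_sum]
    have h2 := sum_Cset_le P T hT.measurable U V hU hV (s + g) K univ MeasurableSet.univ
    rw [inter_univ] at h2
    have h3 : P.real (noV T V (s + g)) ≤ P.real (noV T V s) :=
      measureReal_mono (noV_anti T V (by omega))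
    exact mul_le_mul_of_nonneg_left (h2.trans h3) hφ
  have tri : ∀ k, |P.real (Cset T U V k t ∩ Dt) - P.real D * P.real (Cset T U V k t)| ≤
      |P.real (Cset T U V k t ∩ Dt) - P.real (Cset T U V k (s + g) ∩ Dt)| +
      |P.real (Cset T U V k (s + g) ∩ Dt) - P.real D * P.real (Cset T U V k (s + g))| +
      P.real D * |P.real (Cset T U V k t) - P.real (Cset T U V k (s + g))| := by
    intro k
    have e : P.real D * |P.real (Cset T U V k t) - P.real (Cset T U V k (s + g))| =
      |P.real D * (P.real (Cset T U V k (s + g)) - P.real (Cset T U V k t))| := by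
      rw [abs_mul, abs_of_nonneg hD0, abs_sub_comm]
    rw [e]
    refine le_trans (le_of_eq ?_) ((abs_add_le _ _).trans (add_le_add_left (abs_add_le _ _) _))
    congr 1; ring
  refine (Finset.sum_le_sum fun k _ => tri k).trans ?_
  rw [Finset.sum_add_distrib, Finset.sum_add_distrib, ← Finset.mul_sum]
  have b3'' := mul_le_mul_of_nonneg_left (b3.trans (mul_le_mul_of_nonneg_left b3' zero_le_two)) hD0
  nlinarith

lemma F_bound_trivial (T : Ω → Ω) (hT : MeasurePreserving T P P) (U V D : Set Ω)
    (hU : MeasurableSet U) (hV : MeasurableSet V) (hD : MeasurableSet D) (t K : ℕ) :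
    ∑ k ∈ Finset.range K, |P.real (Cset T U V k t ∩ T^[t] ⁻¹' D)
        - P.real D * P.real (Cset T U V k t)| ≤ 2 * P.real D := by
  have hDtm : MeasurableSet (T^[t] ⁻¹' D) := hT.measurable.iterate t hD
  have hPD : P.real (T^[t] ⁻¹' D) = P.real D :=
    (hT.iterate t).measureReal_preimage hD.nullMeasurableSet
  have hD0 : 0 ≤ P.real D := measureReal_nonneg
  have e : ∀ k ∈ Finset.range K, |P.real (Cset T U V k t ∩ T^[t] ⁻¹' D)
        - P.real D * P.real (Cset T U V k t)| ≤ P.real (Cset T U V k t ∩ T^[t] ⁻¹' D) +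
        P.real D * P.real (Cset T U V k t ∩ univ) := by
    intro k _
    rw [inter_univ]
    have h1 : 0 ≤ P.real (Cset T U V k t ∩ T^[t] ⁻¹' D) := measureReal_nonneg
    have h2 : 0 ≤ P.real D * P.real (Cset T U V k t) := mul_nonneg hD0 measureReal_nonneg
    rw [abs_le]; constructor <;> linarith
  refine (Finset.sum_le_sum e).trans ?_
  rw [Finset.sum_add_distrib, ← Finset.mul_sum]
  have h1 := sum_Cset_le P T hT.measurable U V hU hV t K _ hDtm
  have h2 := sum_Cset_le P T hT.measurable U V hU hV t K _ MeasurableSet.univ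
  have h3 : P.real (noV T V t ∩ T^[t] ⁻¹' D) ≤ P.real D := by
    rw [← hPD]; exact measureReal_mono inter_subset_right
  have h4 : P.real (noV T V t ∩ univ) ≤ 1 := measureReal_le_one
  nlinarith
end det


lemma sum_geom_block (Q : ℕ → ℝ) (h0 : ∀ s, 0 ≤ Q s) (h1 : ∀ s, Q s ≤ 1) (G : ℕ) (θ : ℝ)
    (hθ : 0 < θ) (h : ∀ s, Q (s + G) ≤ (1 - θ) * Q s) (N : ℕ) :
    ∑ s ∈ Finset.range N, Q s ≤ G / θ := by
  have e1 : ∑ s ∈ Finset.range N, Q s ≤ ∑ s ∈ Finset.range (G + N), Q s :=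
    Finset.sum_le_sum_of_subset_of_nonneg (Finset.range_mono (by omega)) fun i _ _ => h0 i
  rw [Finset.sum_range_add] at e1
  have e2 : ∑ s ∈ Finset.range G, Q s ≤ G := by
    refine (Finset.sum_le_card_nsmul _ _ 1 fun i _ => h1 i).trans ?_
    simp
  have e3 : ∑ s ∈ Finset.range N, Q (G + s) ≤ (1 - θ) * ∑ s ∈ Finset.range N, Q s := by
    rw [Finset.mul_sum]
    refine Finset.sum_le_sum fun s _ => ?_
    rw [add_comm]; exact h s
  rw [le_div_iff₀ hθ]
  linarith

lemma tendsto_sum_iUnion {Ω : Type*} [MeasurableSpace Ω] (P : Measure Ω) [IsFiniteMeasure P]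
    (f : ℕ → Set Ω) (hd : Pairwise (Function.onFun Disjoint f)) (hm : ∀ i, MeasurableSet (f i)) :
    Tendsto (fun N => ∑ t ∈ Finset.range N, P.real (f t)) atTop (nhds (P.real (⋃ t, f t))) := by
  have h := measure_iUnion (μ := P) hd hm
  have hne : (∑' k, P (f k)) ≠ ⊤ := by rw [← h]; finiteness
  have := ENNReal.hasSum_toReal hne
  rw [← ENNReal.tsum_toReal_eq (fun k => ENNReal.ne_top_of_tsum_ne_top hne k), ← h] at this
  exact this.tendsto_sum_nat

section det
variable {Ω : Type*}

lemma hit_spec (T : Ω → Ω) (V : Set Ω) (ω : Ω) (h : ∃ t, ω ∉ noV T V t) :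
    1 ≤ hitTime T V ω ∧ T^[hitTime T V ω] ω ∈ V ∧ ω ∈ noV T V (hitTime T V ω) := by
  have hne : {k | 1 ≤ k ∧ T^[k] ω ∈ V}.Nonempty := by
    obtain ⟨t, ht⟩ := h
    simp only [noV, mem_ofPred_eq, not_forall, not_not] at ht
    obtain ⟨i, h1, _, h3⟩ := ht
    exact ⟨i, h1, h3⟩
  have h1 := Nat.sInf_mem hne
  refine ⟨h1.1, h1.2, ?_⟩
  intro i hi1 hi2 hi3
  have : hitTime T V ω ≤ i := Nat.sInf_le ⟨hi1, hi3⟩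
  omega

lemma hit_eq (T : Ω → Ω) (V : Set Ω) (ω : Ω) (t : ℕ) (h1 : 1 ≤ t) (h2 : T^[t] ω ∈ V)
    (h3 : ω ∈ noV T V t) : hitTime T V ω = t := by
  have h := hit_spec T V ω ⟨t + 1, fun h => h t h1 (by omega) h2⟩
  rcases lt_trichotomy (hitTime T V ω) t with h' | h' | h'
  · exact absurd h.2.1 (h3 _ h.1 h')
  · exact h'
  · exact absurd h2 (h.2.2 _ h1 h')

lemma numVisits_eq_cnt (T : Ω → Ω) (U V : Set Ω) (ω : Ω) :
    numVisits T U V ω = cnt T U (hitTime T V ω) ω := rfl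

lemma mem_eq_iff (T : Ω → Ω) (U V : Set Ω) (ω : Ω) (h : ∃ t, ω ∉ noV T V t) (k : ℕ) :
    numVisits T U V ω = k ↔ ω ∈ ⋃ t, (Cset T U V k (t + 1) ∩ T^[t + 1] ⁻¹' V) := by
  rw [numVisits_eq_cnt, mem_iUnion]
  constructor
  · intro hk
    obtain ⟨h1, h2, h3⟩ := hit_spec T V ω h
    refine ⟨hitTime T V ω - 1, ?_⟩
    rw [Nat.sub_add_cancel h1]
    exact ⟨⟨hk, h3⟩, h2⟩
  · rintro ⟨t, ⟨h1, h2⟩, h3⟩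
    rw [hit_eq T V ω (t + 1) (by omega) h3 h2]
    exact h1

lemma mem_ge_iff (T : Ω → Ω) (U V : Set Ω) (hUV : Disjoint U V) (ω : Ω)
    (h : ∃ t, ω ∉ noV T V t) (k : ℕ) :
    k + 1 ≤ numVisits T U V ω ↔ ω ∈ ⋃ t, (Cset T U V k t ∩ T^[t] ⁻¹' U) := by
  rw [numVisits_eq_cnt, mem_iUnion]
  obtain ⟨h1, h2, h3⟩ := hit_spec T V ω h
  constructor
  · intro hk
    have hex : ∃ t, k + 1 ≤ cnt T U t ω := ⟨_, hk⟩
    classical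
    have hf := Nat.find_spec hex
    have hle : Nat.find hex ≤ hitTime T V ω := Nat.find_min' hex hk
    have hpos : Nat.find hex ≠ 0 := by
      intro h0
      rw [h0] at hf
      simp [cnt] at hf
    obtain ⟨t, ht⟩ := Nat.exists_eq_succ_of_ne_zero hpos
    have hlt : ¬ (k + 1 ≤ cnt T U t ω) := Nat.find_min hex (by omega)
    rw [ht, Nat.succ_eq_add_one, cnt_succ] at hf
    have hU : T^[t] ω ∈ U := by
      by_contra hc
      rw [indicator_of_notMem hc] at hf
      omega
    rw [indicator_of_mem hU] at hf
    refine ⟨t, ⟨?_, noV_anti T V (by omega) h3⟩, hU⟩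
    simp only [mem_ofPred_eq]
    omega
  · rintro ⟨t, ⟨h4, h5⟩, h6⟩
    have hlt : t < hitTime T V ω := by
      by_contra hc
      rcases (not_lt.1 hc).lt_or_eq with h' | h'
      · exact h5 _ h1 h' h2
      · rw [h'] at h2
        exact Set.disjoint_left.1 hUV h6 h2
    have := cnt_mono T U ω (show t + 1 ≤ hitTime T V ω by omega)
    simp only [cnt_succ] at this
    rw [indicator_of_mem (show T^[t] ω ∈ U from h6)] at this
    simp only [mem_ofPred_eq] at h4
    omega

variable [MeasurableSpace Ω] (P : Measure Ω) [IsProbabilityMeasure P]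

lemma measurable_numVisits (T : Ω → Ω) (hT : Measurable T) (U V : Set Ω) (hU : MeasurableSet U)
    (hV : MeasurableSet V) : Measurable (numVisits T U V) := by
  apply measurable_to_countable'
  intro k
  have hI : MeasurableSet (⋂ t, noV T V t) :=
    MeasurableSet.iInter fun t => measurableSet_noV _ T V t fun i _ => hT.iterate i hV
  have hA : MeasurableSet (⋃ t, (Cset T U V k (t + 1) ∩ T^[t + 1] ⁻¹' V)) :=
    MeasurableSet.iUnion fun t => (measurableSet_Cset _ T U V k _ (fun i _ => hT.iterate i hU)
      (fun i _ => hT.iterate i hV)).inter (hT.iterate _ hV)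
  have e : numVisits T U V ⁻¹' {k} =
      ((⋃ t, (Cset T U V k (t + 1) ∩ T^[t + 1] ⁻¹' V)) \ (⋂ t, noV T V t)) ∪
        (if k = 0 then (⋂ t, noV T V t) else ∅) := by
    ext ω
    by_cases h : ∃ t, ω ∉ noV T V t
    · have h' : ω ∉ ⋂ t, noV T V t := by simpa using h
      have h'' : ω ∉ (if k = 0 then (⋂ t, noV T V t) else ∅) := by
        split_ifs
        · exact h'
        · simp
      simp only [mem_union, h'', Set.mem_sdiff, h', mem_preimage, mem_singleton_iff,
        mem_eq_iff T U V ω h k]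
      tauto
    · have h' : ω ∈ ⋂ t, noV T V t := by simpa using h
      have h0 : numVisits T U V ω = 0 := by
        have : hitTime T V ω = 0 := by
          unfold hitTime
          rw [Nat.sInf_eq_zero]
          right
          rw [Set.eq_empty_iff_forall_notMem]
          rintro i ⟨hi1, hi2⟩
          exact (mem_iInter.1 h' (i + 1)) i hi1 (by omega) hi2
        rw [numVisits_eq_cnt, this]; simp [cnt]
      simp only [mem_union, Set.mem_sdiff, h', mem_preimage, mem_singleton_iff, h0]
      by_cases hk : k = 0
      · simp [hk, mem_iInter.1 h']
      · simp [hk, Ne.symm hk]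
  rw [e]
  refine (hA.diff hI).union ?_
  split_ifs
  · exact hI
  · exact MeasurableSet.empty

/-- Summation over times of the decoupling errors. -/
lemma F_sum (T : Ω → Ω) (hT : MeasurePreserving T P P) (U V D : Set Ω) (hU : MeasurableSet U)
    (hV : MeasurableSet V) (hD : MeasurableSet D)
    (F G : ℕ → MeasurableSpace Ω)
    (hFU : ∀ i t, i < t → MeasurableSet[F t] (T^[i] ⁻¹' U))
    (hFV : ∀ i t, i < t → MeasurableSet[F t] (T^[i] ⁻¹' V))
    (hGU : ∀ i t, t ≤ i → MeasurableSet[G t] (T^[i] ⁻¹' U))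
    (hGV : ∀ i t, t ≤ i → MeasurableSet[G t] (T^[i] ⁻¹' V))
    (hGD : ∀ i t, t ≤ i → MeasurableSet[G t] (T^[i] ⁻¹' D))
    (g : ℕ) (φ : ℝ) (hφ : 0 ≤ φ)
    (hmix : ∀ s Γ Δ, MeasurableSet[F s] Γ → MeasurableSet[G (s + g)] Δ →
      |P.real (Γ ∩ Δ) - P.real Γ * P.real Δ| ≤ φ * P.real Γ)
    (r : ℝ) (hr0 : 0 ≤ r) (hr : ∀ j, 1 ≤ j → j ≤ g → P.real ((U ∪ V) ∩ T^[j] ⁻¹' D) ≤ r)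
    (S : ℝ) (hS : ∀ N, ∑ s ∈ Finset.range N, P.real (noV T V s) ≤ S)
    (N K : ℕ) :
    ∑ t ∈ Finset.range N, ∑ k ∈ Finset.range K, |P.real (Cset T U V k t ∩ T^[t] ⁻¹' D)
        - P.real D * P.real (Cset T U V k t)| ≤
      4 * g * P.real D +
        S * (2 * (g * r + φ) + φ + 2 * P.real D * (g * P.real (U ∪ V) + φ)) := by
  set f : ℕ → ℝ := fun t => ∑ k ∈ Finset.range K, |P.real (Cset T U V k t ∩ T^[t] ⁻¹' D)
        - P.real D * P.real (Cset T U V k t)| with hf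
  have hf0 : ∀ t, 0 ≤ f t := fun t => Finset.sum_nonneg fun k _ => abs_nonneg _
  have e1 : ∑ s ∈ Finset.range N, f s ≤ ∑ s ∈ Finset.range (2 * g + N), f s :=
    Finset.sum_le_sum_of_subset_of_nonneg (Finset.range_mono (by omega)) fun i _ _ => hf0 i
  rw [Finset.sum_range_add] at e1
  have e2 : ∑ s ∈ Finset.range (2 * g), f s ≤ 4 * g * P.real D := by
    refine (Finset.sum_le_card_nsmul _ _ _ fun i _ =>
      F_bound_trivial P T hT U V D hU hV hD i K).trans (le_of_eq ?_)
    simp; ring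
  have hP0 : 0 ≤ P.real D := measureReal_nonneg
  have hP1 : 0 ≤ P.real (U ∪ V) := measureReal_nonneg
  have hK : 0 ≤ (2 * (g * r + φ) + φ + 2 * P.real D * (g * P.real (U ∪ V) + φ)) := by positivity
  have e3 : ∑ s ∈ Finset.range N, f (2 * g + s) ≤
      S * (2 * (g * r + φ) + φ + 2 * P.real D * (g * P.real (U ∪ V) + φ)) := by
    refine (Finset.sum_le_sum fun s _ => ?_).trans
      (le_trans (le_of_eq (Finset.sum_mul _ _ _).symm) (mul_le_mul_of_nonneg_right (hS N) hK))
    rw [add_comm]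
    exact F_bound P T hT U V D hU hV hD F G hFU hFV hGU hGV hGD g φ hφ hmix r hr s K
  linarith

theorem main_det (T : Ω → Ω) (hT : MeasurePreserving T P P) (U V : Set Ω) (hU : MeasurableSet U)
    (hV : MeasurableSet V) (hUV : Disjoint U V)
    (F G : ℕ → MeasurableSpace Ω)
    (hFU : ∀ i t, i < t → MeasurableSet[F t] (T^[i] ⁻¹' U))
    (hFV : ∀ i t, i < t → MeasurableSet[F t] (T^[i] ⁻¹' V))
    (hGU : ∀ i t, t ≤ i → MeasurableSet[G t] (T^[i] ⁻¹' U))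
    (hGV : ∀ i t, t ≤ i → MeasurableSet[G t] (T^[i] ⁻¹' V))
    (g : ℕ) (hg : 1 ≤ g) (φ : ℝ) (hφ : 0 ≤ φ)
    (hmix : ∀ s Γ Δ, MeasurableSet[F s] Γ → MeasurableSet[G (s + g)] Δ →
      |P.real (Γ ∩ Δ) - P.real Γ * P.real Δ| ≤ φ * P.real Γ)
    (hp : 0 < P.real U) (hq : 0 < P.real V) (hφq : φ ≤ P.real V / 2)
    (rU rV : ℝ) (hrU0 : 0 ≤ rU) (hrV0 : 0 ≤ rV)
    (hrU : ∀ j, 1 ≤ j → j ≤ g → P.real ((U ∪ V) ∩ T^[j] ⁻¹' U) ≤ rU)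
    (hrV : ∀ j, 1 ≤ j → j ≤ g → P.real ((U ∪ V) ∩ T^[j] ⁻¹' V) ≤ rV) :
    dTV (P.map (numVisits T U V)) (geoMeasure (P.real V / (P.real V + P.real U))) ≤
      2 * ((P.real U * (4 * g * P.real V + (4 * g / P.real V) *
          (2 * (g * rV + φ) + φ + 2 * P.real V * (g * P.real (U ∪ V) + φ))) +
        P.real V * (4 * g * P.real U + (4 * g / P.real V) *
          (2 * (g * rU + φ) + φ + 2 * P.real U * (g * P.real (U ∪ V) + φ))) +
        P.real U * P.real V) / (P.real V + P.real U)) := by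
  set p := P.real U with hpdef
  set q := P.real V with hqdef
  set BV := 4 * g * q + (4 * g / q) * (2 * (g * rV + φ) + φ + 2 * q * (g * P.real (U ∪ V) + φ))
    with hBV
  set BU := 4 * g * p + (4 * g / q) * (2 * (g * rU + φ) + φ + 2 * p * (g * P.real (U ∪ V) + φ))
    with hBU
  -- sum of the survival probabilities
  have hnVm : ∀ t, MeasurableSet (noV T V t) :=
    fun t => measurableSet_noV _ T V t fun i _ => hT.measurable.iterate i hV
  have hS : ∀ N, ∑ s ∈ Finset.range N, P.real (noV T V s) ≤ 4 * g / q := by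
    intro N
    have := sum_geom_block (fun s => P.real (noV T V s)) (fun s => measureReal_nonneg)
      (fun s => measureReal_le_one) (g + 1) (q / 2) (by linarith) ?_ N
    · refine this.trans ?_
      rw [div_le_div_iff₀ (by positivity) hq]
      push_cast
      have : (1 : ℝ) ≤ g := by exact_mod_cast hg
      nlinarith
    · intro s
      have hsub : noV T V (s + (g + 1)) ⊆ noV T V s ∩ (T^[s + g] ⁻¹' V)ᶜ := by
        intro ω hω
        exact ⟨noV_anti T V (by omega) hω, hω (s + g) (by omega) (by omega)⟩
      have h1 := (abs_le.1 (hmix s (noV T V s) ((T^[s + g] ⁻¹' V)ᶜ)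
        (measurableSet_noV _ _ _ _ fun i hi => hFV i s hi) (hGV _ _ le_rfl).compl)).2
      have h2 : P.real ((T^[s + g] ⁻¹' V)ᶜ) = 1 - q := by
        rw [measureReal_compl (hT.measurable.iterate _ hV),
          (hT.iterate _).measureReal_preimage hV.nullMeasurableSet]
        simp [hqdef]
      have h3 : P.real (noV T V (s + (g + 1))) ≤ _ := measureReal_mono hsub
      have h4 : 0 ≤ P.real (noV T V s) := measureReal_nonneg
      rw [h2] at h1
      nlinarith
  -- a.e. finiteness
  have hae : ∀ᵐ ω ∂P, ∃ t, ω ∉ noV T V t := by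
    have : P (⋂ t, noV T V t) = 0 := by
      have h0 : P.real (⋂ t, noV T V t) = 0 := by
        by_contra hne
        have hpos : 0 < P.real (⋂ t, noV T V t) := lt_of_le_of_ne measureReal_nonneg (Ne.symm hne)
        obtain ⟨N, hN⟩ := exists_nat_gt ((4 * g / q) / P.real (⋂ t, noV T V t))
        rw [div_lt_iff₀ hpos] at hN
        have h1 : (N : ℝ) * P.real (⋂ t, noV T V t) ≤
            ∑ s ∈ Finset.range N, P.real (noV T V s) := by
          have := Finset.card_nsmul_le_sum (Finset.range N) (fun s => P.real (noV T V s))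
            (P.real (⋂ t, noV T V t)) (fun s _ => measureReal_mono (iInter_subset _ s))
          simpa using this
        linarith [hS N]
      rwa [measureReal_eq_zero_iff] at h0
    have h := measure_eq_zero_iff_ae_notMem.1 this
    filter_upwards [h] with ω hω
    simpa using hω
  have hmeas := measurable_numVisits T hT.measurable U V hU hV
  have : IsProbabilityMeasure (P.map (numVisits T U V)) :=
    Measure.isProbabilityMeasure_map hmeas.aemeasurable
  have hCm : ∀ k t, MeasurableSet (Cset T U V k t) := fun k t =>
    measurableSet_Cset _ T U V k t (fun i _ => hT.measurable.iterate i hU)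
      (fun i _ => hT.measurable.iterate i hV)
  -- the law
  set d : ℕ → ℝ := fun k => (P.map (numVisits T U V)).real {k} with hd
  set S : ℕ → ℝ := fun k => (P.map (numVisits T U V)).real (Ici k) with hSd
  have hdlim : ∀ k, Tendsto (fun N => ∑ t ∈ Finset.range N,
      P.real (Cset T U V k (t + 1) ∩ T^[t + 1] ⁻¹' V)) atTop (nhds (d k)) := by
    intro k
    have e : d k = P.real (⋃ t, (Cset T U V k (t + 1) ∩ T^[t + 1] ⁻¹' V)) := by
      rw [hd]
      simp only
      rw [map_measureReal_apply hmeas (MeasurableSet.singleton k)]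
      apply measureReal_congr
      filter_upwards [hae] with ω hω
      exact propext (mem_eq_iff T U V ω hω k)
    rw [e]
    apply tendsto_sum_iUnion
    · intro i j hij
      rw [Function.onFun, Set.disjoint_left]
      rintro ω ⟨h1, h2⟩ ⟨h3, h4⟩
      have a1 := hit_eq T V ω (i + 1) (by omega) h2 h1.2
      have a2 := hit_eq T V ω (j + 1) (by omega) h4 h3.2
      omega
    · intro t
      exact (hCm k _).inter (hT.measurable.iterate _ hV)
  have hSlim : ∀ k, Tendsto (fun N => ∑ t ∈ Finset.range N,
      P.real (Cset T U V k t ∩ T^[t] ⁻¹' U)) atTop (nhds (S (k + 1))) := by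
    intro k
    have e : S (k + 1) = P.real (⋃ t, (Cset T U V k t ∩ T^[t] ⁻¹' U)) := by
      rw [hSd]
      simp only
      rw [map_measureReal_apply hmeas (MeasurableSet.of_discrete)]
      apply measureReal_congr
      filter_upwards [hae] with ω hω
      exact propext (mem_ge_iff T U V hUV ω hω k)
    rw [e]
    apply tendsto_sum_iUnion
    · have key : ∀ i j, i < j → ∀ ω, ω ∈ Cset T U V k i ∩ T^[i] ⁻¹' U →
          ω ∈ Cset T U V k j ∩ T^[j] ⁻¹' U → False := by
        rintro i j hij ω ⟨⟨h1, _⟩, h2⟩ ⟨⟨h3, _⟩, _⟩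
        have := cnt_mono T U ω (show i + 1 ≤ j by omega)
        simp only [cnt_succ] at this
        rw [indicator_of_mem (show T^[i] ω ∈ U from h2)] at this
        simp only [mem_ofPred_eq] at h1 h3
        omega
      intro i j hij
      rw [Function.onFun, Set.disjoint_left]
      intro ω h1 h2
      rcases lt_or_gt_of_ne hij with h | h
      · exact key i j h ω h1 h2
      · exact key j i h ω h2 h1
    · intro t
      exact (hCm k _).inter (hT.measurable.iterate _ hU)
  have hrec : ∀ k, S k = d k + S (k + 1) := by
    intro k
    have e : Ici k = {k} ∪ Ici (k + 1) := by ext x; simp; omega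
    change (P.map (numVisits T U V)).real (Ici k) = (P.map (numVisits T U V)).real {k} +
      (P.map (numVisits T U V)).real (Ici (k + 1))
    rw [e, measureReal_union _ (MeasurableSet.of_discrete)]
    simp
  have hpq : 0 < q + p := by positivity
  refine dTV_geo_le _ _ _ (by positivity) ((div_le_one hpq).2 (by linarith)) fun K => ?_
  have hterm : ∀ k, |d k - q / (q + p) * S k| = |p * d k - q * S (k + 1)| / (q + p) := by
    intro k
    rw [hrec k, ← abs_of_pos hpq, ← abs_div, abs_of_pos hpq]
    congr 1
    field_simp
    ring
  change ∑ k ∈ Finset.range K, |d k - q / (q + p) * S k| ≤ _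
  simp only [hterm]
  rw [← Finset.sum_div]
  refine div_le_div_of_nonneg_right ?_ hpq.le
  -- limit of finite time sums
  have hlim : Tendsto (fun N => ∑ k ∈ Finset.range K,
      |p * ∑ t ∈ Finset.range N, P.real (Cset T U V k (t + 1) ∩ T^[t + 1] ⁻¹' V)
        - q * ∑ t ∈ Finset.range (N + 1), P.real (Cset T U V k t ∩ T^[t] ⁻¹' U)|) atTop
      (nhds (∑ k ∈ Finset.range K, |p * d k - q * S (k + 1)|)) := by
    apply tendsto_finsetSum
    intro k _
    exact (((hdlim k).const_mul p).sub
      (((hSlim k).comp (tendsto_add_atTop_nat 1)).const_mul q)).abs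
  refine le_of_tendsto hlim (Eventually.of_forall fun N => ?_)
  have bV := F_sum P T hT U V V hU hV hV F G hFU hFV hGU hGV hGV g φ hφ hmix rV hrV0 hrV
    (4 * g / q) hS (N + 1) K
  have bU := F_sum P T hT U V U hU hV hU F G hFU hFV hGU hGV hGU g φ hφ hmix rU hrU0 hrU
    (4 * g / q) hS (N + 1) K
  rw [← hqdef, ← hBV] at bV
  rw [← hpdef, ← hBU] at bU
  rw [Finset.sum_comm] at bV bU
  have b0 : ∑ k ∈ Finset.range K, P.real (Cset T U V k 0 ∩ T^[0] ⁻¹' V) ≤ q := by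
    refine (sum_Cset_le P T hT.measurable U V hU hV 0 K _ (hT.measurable.iterate 0 hV)).trans ?_
    exact measureReal_mono inter_subset_right
  have hk : ∀ k ∈ Finset.range K,
      |p * ∑ t ∈ Finset.range N, P.real (Cset T U V k (t + 1) ∩ T^[t + 1] ⁻¹' V)
        - q * ∑ t ∈ Finset.range (N + 1), P.real (Cset T U V k t ∩ T^[t] ⁻¹' U)| ≤
      p * (∑ t ∈ Finset.range (N + 1), |P.real (Cset T U V k t ∩ T^[t] ⁻¹' V)
        - q * P.real (Cset T U V k t)|) +
      q * (∑ t ∈ Finset.range (N + 1), |P.real (Cset T U V k t ∩ T^[t] ⁻¹' U)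
        - p * P.real (Cset T U V k t)|) + p * P.real (Cset T U V k 0 ∩ T^[0] ⁻¹' V) := by
    intro k _
    have e0 : ∑ t ∈ Finset.range N, P.real (Cset T U V k (t + 1) ∩ T^[t + 1] ⁻¹' V) =
        ∑ t ∈ Finset.range (N + 1), P.real (Cset T U V k t ∩ T^[t] ⁻¹' V)
        - P.real (Cset T U V k 0 ∩ T^[0] ⁻¹' V) := by
      rw [Finset.sum_range_succ']; ring
    have e1 : p * ∑ t ∈ Finset.range N, P.real (Cset T U V k (t + 1) ∩ T^[t + 1] ⁻¹' V)
        - q * ∑ t ∈ Finset.range (N + 1), P.real (Cset T U V k t ∩ T^[t] ⁻¹' U) =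
        p * (∑ t ∈ Finset.range (N + 1), (P.real (Cset T U V k t ∩ T^[t] ⁻¹' V)
        - q * P.real (Cset T U V k t)))
        - q * (∑ t ∈ Finset.range (N + 1), (P.real (Cset T U V k t ∩ T^[t] ⁻¹' U)
        - p * P.real (Cset T U V k t))) - p * P.real (Cset T U V k 0 ∩ T^[0] ⁻¹' V) := by
      rw [e0, Finset.sum_sub_distrib, Finset.sum_sub_distrib, ← Finset.mul_sum, ← Finset.mul_sum]
      ring
    rw [e1]
    have a1 := Finset.abs_sum_le_sum_abs (fun t => (P.real (Cset T U V k t ∩ T^[t] ⁻¹' V)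
        - q * P.real (Cset T U V k t))) (Finset.range (N + 1))
    have a2 := Finset.abs_sum_le_sum_abs (fun t => (P.real (Cset T U V k t ∩ T^[t] ⁻¹' U)
        - p * P.real (Cset T U V k t))) (Finset.range (N + 1))
    refine (abs_sub _ _).trans (add_le_add ((abs_sub _ _).trans (add_le_add ?_ ?_)) ?_)
    · rw [abs_mul, abs_of_pos hp]; exact mul_le_mul_of_nonneg_left a1 hp.le
    · rw [abs_mul, abs_of_pos hq]; exact mul_le_mul_of_nonneg_left a2 hq.le
    · rw [abs_of_nonneg (mul_nonneg hp.le measureReal_nonneg)]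
  refine (Finset.sum_le_sum hk).trans ?_
  rw [Finset.sum_add_distrib, Finset.sum_add_distrib, ← Finset.mul_sum, ← Finset.mul_sum,
    ← Finset.mul_sum]
  exact add_le_add (add_le_add (mul_le_mul_of_nonneg_left bV hp.le)
    (mul_le_mul_of_nonneg_left bU hq.le)) (mul_le_mul_of_nonneg_left b0 hp.le)
end det


lemma det_arith (p q g ε a x w : ℝ) (hp : 0 < p) (hq : 0 < q) (hp1 : p ≤ 1) (hq1 : q ≤ 1)
    (hg : 1 ≤ g) (hε : 0 ≤ ε) (ha : 0 ≤ a) (hx : 0 ≤ x) (hw : w ≤ p + q) :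
    (p * (4 * g * q + (4 * g / q) *
          (2 * (g * (ε * q + a * p * q) + x * q) + x * q + 2 * q * (g * w + x * q))) +
        q * (4 * g * p + (4 * g / q) *
          (2 * (g * (ε * p + a * p * q) + x * q) + x * q + 2 * p * (g * w + x * q))) +
        p * q) / (q + p) ≤ 16 * g ^ 2 * ε + 25 * g ^ 2 * (1 + a) * (p + q) + 40 * g * x := by
  have hpq : 0 < q + p := by positivity
  rw [div_le_iff₀ hpq]
  have e1 : p * (4 * g * q + (4 * g / q) *
          (2 * (g * (ε * q + a * p * q) + x * q) + x * q + 2 * q * (g * w + x * q))) =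
      4 * g * p * q + 4 * g * p * (2 * g * ε + 2 * g * a * p + 3 * x + 2 * g * w + 2 * x * q) := by
    field_simp; ring
  have e2 : q * (4 * g * p + (4 * g / q) *
          (2 * (g * (ε * p + a * p * q) + x * q) + x * q + 2 * p * (g * w + x * q))) =
      4 * g * p * q + 4 * g * (2 * g * ε * p + 2 * g * a * p * q + 3 * x * q + 2 * p * g * w
        + 2 * p * x * q) := by
    field_simp; ring
  rw [e1, e2]
  have g1 : g ≤ g ^ 2 := by nlinarith
  have i1 : 8 * g * (p * q) + p * q ≤ 9 * g ^ 2 * (p + q) ^ 2 := by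
    have a1 : p * q ≤ (p + q) ^ 2 := by nlinarith [mul_pos hp hq]
    have a2 : 8 * g + 1 ≤ 9 * g ^ 2 := by nlinarith
    calc 8 * g * (p * q) + p * q = (8 * g + 1) * (p * q) := by ring
      _ ≤ (9 * g ^ 2) * (p + q) ^ 2 := by
        apply mul_le_mul a2 a1 (by positivity) (by positivity)
  have i2 : 16 * g ^ 2 * ε * p ≤ 16 * g ^ 2 * ε * (q + p) := by
    apply mul_le_mul_of_nonneg_left (by linarith) (by positivity)
  have i3 : 8 * g ^ 2 * a * p * (p + q) ≤ 25 * g ^ 2 * a * (p + q) * (p + q) := by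
    apply mul_le_mul_of_nonneg_right _ (by positivity)
    have : 0 ≤ g ^ 2 * a := by positivity
    nlinarith
  have i4 : 12 * g * x * (p + q) + 16 * g * x * (p * q) ≤ 40 * g * x * (q + p) := by
    have a1 : p * q ≤ p + q := by nlinarith
    have : 0 ≤ g * x := by positivity
    nlinarith
  have i5 : 16 * g ^ 2 * p * w ≤ 16 * g ^ 2 * (p + q) ^ 2 := by
    have a1 : p * w ≤ (p + q) ^ 2 := by nlinarith
    have : 0 ≤ g ^ 2 := by positivity
    nlinarith
  nlinarith

/-- Clean form of the deterministic estimate. -/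
theorem main_det' {Ω : Type*} [MeasurableSpace Ω] (P : Measure Ω) [IsProbabilityMeasure P]
    (T : Ω → Ω) (hT : MeasurePreserving T P P) (U V : Set Ω) (hU : MeasurableSet U)
    (hV : MeasurableSet V) (hUV : Disjoint U V)
    (F G : ℕ → MeasurableSpace Ω)
    (hFU : ∀ i t, i < t → MeasurableSet[F t] (T^[i] ⁻¹' U))
    (hFV : ∀ i t, i < t → MeasurableSet[F t] (T^[i] ⁻¹' V))
    (hGU : ∀ i t, t ≤ i → MeasurableSet[G t] (T^[i] ⁻¹' U))
    (hGV : ∀ i t, t ≤ i → MeasurableSet[G t] (T^[i] ⁻¹' V))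
    (g : ℕ) (hg : 1 ≤ g) (φ : ℝ) (hφ : 0 ≤ φ)
    (hmix : ∀ s Γ Δ, MeasurableSet[F s] Γ → MeasurableSet[G (s + g)] Δ →
      |P.real (Γ ∩ Δ) - P.real Γ * P.real Δ| ≤ φ * P.real Γ)
    (hp : 0 < P.real U) (hq : 0 < P.real V) (hφq : φ / P.real V ≤ 1 / 2)
    (ε a : ℝ) (hε : 0 ≤ ε) (ha : 0 ≤ a)
    (hUU : ∀ j, 1 ≤ j → j ≤ g → P.real (U ∩ T^[j] ⁻¹' U) ≤ ε * P.real U)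
    (hVV : ∀ j, 1 ≤ j → j ≤ g → P.real (V ∩ T^[j] ⁻¹' V) ≤ ε * P.real V)
    (hUV' : ∀ j, 1 ≤ j → j ≤ g → P.real (U ∩ T^[j] ⁻¹' V) ≤ a * P.real U * P.real V)
    (hVU : ∀ j, 1 ≤ j → j ≤ g → P.real (V ∩ T^[j] ⁻¹' U) ≤ a * P.real U * P.real V) :
    dTV (P.map (numVisits T U V)) (geoMeasure (P.real V / (P.real V + P.real U))) ≤
      2 * (16 * (g : ℝ) ^ 2 * ε + 25 * (g : ℝ) ^ 2 * (1 + a) * (P.real U + P.real V)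
        + 40 * g * (φ / P.real V)) := by
  have hx : φ = φ / P.real V * P.real V := by field_simp
  have key := main_det P T hT U V hU hV hUV F G hFU hFV hGU hGV g hg φ hφ hmix hp hq
    (by rw [div_le_iff₀ hq] at hφq; linarith)
    (ε * P.real U + a * P.real U * P.real V) (ε * P.real V + a * P.real U * P.real V)
    (by positivity) (by positivity)
    (fun j h1 h2 => by
      rw [union_inter_distrib_right]
      exact (measureReal_union_le _ _).trans (add_le_add (hUU j h1 h2) (hVU j h1 h2)))
    (fun j h1 h2 => by
      rw [union_inter_distrib_right, add_comm]
      exact (measureReal_union_le _ _).trans (add_le_add (hUV' j h1 h2) (hVV j h1 h2)))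
  refine key.trans ?_
  have := det_arith (P.real U) (P.real V) g ε a (φ / P.real V) (P.real (U ∪ V)) hp hq
    measureReal_le_one measureReal_le_one (by exact_mod_cast hg) hε ha (by positivity)
    (measureReal_union_le _ _)
  rw [← hx] at this
  linarith


lemma shift_iterate {𝓐 : Type*} (i : ℕ) (ω : ℕ → 𝓐) (k : ℕ) : ((shift 𝓐)^[i] ω) k = ω (i + k) := by
  induction i generalizing ω with
  | zero => simp
  | succ i ih =>
    rw [Function.iterate_succ_apply, ih]
    simp only [shift]
    congr 1; omega

lemma pre_cyl {𝓐 : Type*} (ξ : ℕ → 𝓐) (n i : ℕ) :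
    (shift 𝓐)^[i] ⁻¹' cyl ξ n = {ω | ∀ k < n, ω (i + k) = ξ k} := by
  ext ω
  simp [cyl, shift_iterate]

section symb
variable {𝓐 : Type*} [MeasurableSpace 𝓐]

lemma coordAlg_mono {s t : Set ℕ} (h : s ⊆ t) : coordAlg 𝓐 s ≤ coordAlg 𝓐 t :=
  iSup₂_le fun i hi => le_iSup₂_of_le i (h hi) le_rfl

lemma coordAlg_le (s : Set ℕ) : coordAlg 𝓐 s ≤ (MeasurableSpace.pi : MeasurableSpace (ℕ → 𝓐)) :=
  iSup₂_le fun i _ => (measurable_pi_apply i).comap_le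

lemma measurableSet_coord {s : Set ℕ} {i : ℕ} (hi : i ∈ s) (B : Set 𝓐) (hB : MeasurableSet B) :
    MeasurableSet[coordAlg 𝓐 s] {ω : ℕ → 𝓐 | ω i ∈ B} := by
  have h : (MeasurableSpace.comap (fun ω : ℕ → 𝓐 => ω i) ‹MeasurableSpace 𝓐›) ≤ coordAlg 𝓐 s :=
    le_iSup₂_of_le i hi le_rfl
  exact h _ ⟨B, hB, rfl⟩

lemma measurableSet_pre_cyl [DiscreteMeasurableSpace 𝓐] (ξ : ℕ → 𝓐) (n i : ℕ) (s : Set ℕ)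
    (h : ∀ k < n, i + k ∈ s) : MeasurableSet[coordAlg 𝓐 s] ((shift 𝓐)^[i] ⁻¹' cyl ξ n) := by
  rw [pre_cyl]
  have : {ω : ℕ → 𝓐 | ∀ k < n, ω (i + k) = ξ k} =
      ⋂ k, ⋂ (_ : k < n), {ω : ℕ → 𝓐 | ω (i + k) ∈ ({ξ k} : Set 𝓐)} := by
    ext ω; simp
  rw [this]
  exact MeasurableSet.iInter fun k => MeasurableSet.iInter fun hk =>
    measurableSet_coord (h k hk) _ (MeasurableSet.of_discrete)

lemma measurableSet_cyl [DiscreteMeasurableSpace 𝓐] (ξ : ℕ → 𝓐) (n : ℕ) :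
    MeasurableSet (cyl ξ n) :=
  coordAlg_le univ _ (measurableSet_pre_cyl ξ n 0 univ (by simp))

variable (P : Measure (ℕ → 𝓐)) [IsProbabilityMeasure P]

lemma phi_val_le_one (Γ Δ : Set (ℕ → 𝓐)) :
    |(P (Γ ∩ Δ)).toReal / (P Γ).toReal - (P Δ).toReal| ≤ 1 := by
  have h1 : (P Δ).toReal ≤ 1 := measureReal_le_one (μ := P)
  have h2 : 0 ≤ (P Δ).toReal := ENNReal.toReal_nonneg
  have h3 : (P (Γ ∩ Δ)).toReal / (P Γ).toReal ≤ 1 :=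
    div_le_one_of_le₀ (measureReal_mono (μ := P) inter_subset_left) ENNReal.toReal_nonneg
  have h4 : 0 ≤ (P (Γ ∩ Δ)).toReal / (P Γ).toReal := by positivity
  rw [abs_le]; constructor <;> linarith

lemma mix_of_phi (β : ℝ)
    (hφ : ∀ n : ℕ, 1 ≤ n → phiMix 𝓐 P n ≤ β⁻¹ * Real.exp (-β * n))
    (s j : ℕ) (hj : 1 ≤ j) (Γ Δ : Set (ℕ → 𝓐)) (hΓ : MeasurableSet[coordAlg 𝓐 (Iic s)] Γ)
    (hΔ : MeasurableSet[coordAlg 𝓐 (Ici (s + j))] Δ) :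
    |P.real (Γ ∩ Δ) - P.real Γ * P.real Δ| ≤ β⁻¹ * Real.exp (-β * j) * P.real Γ := by
  by_cases h0 : P Γ = 0
  · have h1 : P.real Γ = 0 := by simp [Measure.real, h0]
    have h2 : P.real (Γ ∩ Δ) = 0 := by
      have := measure_mono_null (inter_subset_left : Γ ∩ Δ ⊆ Γ) h0
      simp [Measure.real, this]
    simp [h1, h2]
  have hpos : 0 < P.real Γ := ENNReal.toReal_pos h0 (measure_ne_top _ _)
  have hb : ∀ m, BddAbove {x | ∃ Γ Δ : Set (ℕ → 𝓐), MeasurableSet[coordAlg 𝓐 (Iic m)] Γ ∧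
      MeasurableSet[coordAlg 𝓐 (Ici (m + j))] Δ ∧ P Γ ≠ 0 ∧
      x = |(P (Γ ∩ Δ)).toReal / (P Γ).toReal - (P Δ).toReal|} := by
    intro m
    refine ⟨1, ?_⟩
    rintro x ⟨Γ, Δ, _, _, _, rfl⟩
    exact phi_val_le_one P Γ Δ
  have h1 : |(P (Γ ∩ Δ)).toReal / (P Γ).toReal - (P Δ).toReal| ≤
      phiCoef P (coordAlg 𝓐 (Iic s)) (coordAlg 𝓐 (Ici (s + j))) :=
    le_csSup (hb s) ⟨Γ, Δ, hΓ, hΔ, h0, rfl⟩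
  have h2 : phiCoef P (coordAlg 𝓐 (Iic s)) (coordAlg 𝓐 (Ici (s + j))) ≤ phiMix 𝓐 P j := by
    refine le_ciSup (f := fun m => phiCoef P (coordAlg 𝓐 (Iic m)) (coordAlg 𝓐 (Ici (m + j))))
      ⟨1, ?_⟩ s
    rintro x ⟨m, rfl⟩
    refine Real.sSup_le ?_ zero_le_one
    rintro x ⟨Γ, Δ, _, _, _, rfl⟩
    exact phi_val_le_one P Γ Δ
  have h3 := (h1.trans h2).trans (hφ j hj)
  have e : P.real (Γ ∩ Δ) - P.real Γ * P.real Δ =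
      (P.real (Γ ∩ Δ) / P.real Γ - P.real Δ) * P.real Γ := by
    field_simp
  rw [e, abs_mul, abs_of_pos hpos]
  exact mul_le_mul_of_nonneg_right h3 hpos.le

lemma pow_div_bound (r : ℝ) (h0 : 0 < r) (h1 : r < 1) (d : ℕ) (hd : 1 ≤ d) :
    ∃ r' : ℝ, 0 < r' ∧ r' < 1 ∧ ∀ n : ℕ, r ^ (n / d) ≤ r⁻¹ * r' ^ n := by
  refine ⟨r ^ ((d : ℝ)⁻¹), Real.rpow_pos_of_pos h0 _, Real.rpow_lt_one h0.le h1 (by positivity), ?_⟩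
  intro n
  have e1 : (r ^ ((d : ℝ)⁻¹)) ^ n = r ^ ((n : ℝ) / d) := by
    rw [← Real.rpow_natCast, ← Real.rpow_mul h0.le]; congr 1; ring
  have e2 : r⁻¹ = r ^ (-1 : ℝ) := by rw [Real.rpow_neg_one]
  rw [e1, e2, ← Real.rpow_add h0, ← Real.rpow_natCast]
  apply Real.rpow_le_rpow_of_exponent_ge h0 h1.le
  have hd' : (0 : ℝ) < d := by exact_mod_cast hd
  have h2 : n < d * (n / d) + d := by
    have := Nat.div_add_mod n d
    have := Nat.mod_lt n (show d > 0 by omega)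
    omega
  have h3 : (n : ℝ) < d * (n / d : ℕ) + d := by exact_mod_cast h2
  have : (n : ℝ) / d < (n / d : ℕ) + 1 := by
    rw [div_lt_iff₀ hd']; nlinarith
  linarith

/-- uniform exponential decay of cylinders -/
lemma cyl_decay [DiscreteMeasurableSpace 𝓐] [Nontrivial 𝓐]
    (hinv : MeasurePreserving (shift 𝓐) P P)
    (hpos : ∀ a : 𝓐, 0 < P {ω | ω 0 = a}) (β : ℝ) (hβ : 0 < β)
    (hφ : ∀ n : ℕ, 1 ≤ n → phiMix 𝓐 P n ≤ β⁻¹ * Real.exp (-β * n)) :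
    ∃ C r : ℝ, 1 ≤ C ∧ 0 < r ∧ r < 1 ∧ ∀ (ξ : ℕ → 𝓐) n, P.real (cyl ξ n) ≤ C * r ^ n := by
  have hms : ∀ a : 𝓐, MeasurableSet {ω : ℕ → 𝓐 | ω 0 = a} := fun a =>
    coordAlg_le univ _ (measurableSet_coord (mem_univ 0) {a} MeasurableSet.of_discrete)
  obtain ⟨a0, a1, hne⟩ := exists_pair_ne 𝓐
  have hr : ∀ a : 𝓐, 0 < P.real {ω | ω 0 = a} := fun a =>
    ENNReal.toReal_pos (hpos a).ne' (measure_ne_top _ _)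
  obtain ⟨δ, hδ0, hδ1, hδ⟩ : ∃ δ : ℝ, 0 < δ ∧ δ < 1 ∧ ∀ a : 𝓐, P.real {ω | ω 0 = a} ≤ 1 - δ := by
    have hdj : ∀ a b : 𝓐, a ≠ b → P.real {ω | ω 0 = a} + P.real {ω | ω 0 = b} ≤ 1 := by
      intro a b hab
      rw [← measureReal_union _ (hms b)]
      · exact measureReal_le_one
      · rw [Set.disjoint_left]
        intro ω h1 h2
        exact hab (h1.symm.trans h2)
    refine ⟨min (P.real {ω | ω 0 = a0}) (P.real {ω | ω 0 = a1}), lt_min (hr _) (hr _), ?_, ?_⟩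
    · have := hdj a0 a1 hne
      have := hr a1
      exact (min_le_left _ _).trans_lt (by linarith)
    · intro a
      by_cases h : a = a0
      · have := hdj a a1 (h ▸ hne)
        have := min_le_right (P.real {ω | ω 0 = a0}) (P.real {ω | ω 0 = a1})
        linarith
      · have := hdj a a0 h
        have := min_le_left (P.real {ω | ω 0 = a0}) (P.real {ω | ω 0 = a1})
        linarith
  obtain ⟨J, hJ1, hJ⟩ : ∃ J : ℕ, 1 ≤ J ∧ β⁻¹ * Real.exp (-β * J) ≤ δ / 2 := by
    have : Tendsto (fun J : ℕ => β⁻¹ * Real.exp (-β * J)) atTop (nhds (β⁻¹ * 0)) := by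
      apply Tendsto.const_mul
      apply Real.tendsto_exp_atBot.comp
      exact Tendsto.const_mul_atTop_of_neg (by linarith) tendsto_natCast_atTop_atTop
    rw [mul_zero] at this
    have h1 := this.eventually (ge_mem_nhds (show 0 < δ / 2 by linarith))
    obtain ⟨J, hJ⟩ := (h1.and (eventually_ge_atTop 1)).exists
    exact ⟨J, hJ.2, hJ.1⟩
  have step : ∀ (ξ : ℕ → 𝓐) n, P.real (cyl ξ (n + J)) ≤ (1 - δ / 2) * P.real (cyl ξ n) := by
    intro ξ n
    have hsing : ∀ i, P.real ((shift 𝓐)^[i] ⁻¹' {ω | ω 0 = ξ i}) ≤ 1 - δ := by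
      intro i
      rw [(hinv.iterate i).measureReal_preimage (hms _).nullMeasurableSet]
      exact hδ _
    have hsub : cyl ξ (n + J) ⊆ cyl ξ n ∩ (shift 𝓐)^[n + J - 1] ⁻¹' {ω | ω 0 = ξ (n + J - 1)} := by
      intro ω hω
      refine ⟨fun i hi => hω i (by omega), ?_⟩
      simp only [mem_preimage, mem_ofPred_eq, shift_iterate, add_zero]
      exact hω _ (by omega)
    refine (measureReal_mono hsub).trans ?_
    rcases Nat.eq_zero_or_pos n with h | h
    · subst h
      have e : cyl ξ 0 = univ := by ext; simp [cyl]
      rw [e, univ_inter]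
      have := hsing (0 + J - 1)
      simp only [probReal_univ]
      linarith
    · have h1 := (abs_le.1 (mix_of_phi P β hφ (n - 1) J hJ1 (cyl ξ n)
        ((shift 𝓐)^[n + J - 1] ⁻¹' {ω | ω 0 = ξ (n + J - 1)})
        (measurableSet_pre_cyl ξ n 0 _ (fun k hk => by simp; omega)) ?_)).2
      · have h2 := hsing (n + J - 1)
        have h3 : 0 ≤ P.real (cyl ξ n) := measureReal_nonneg
        nlinarith
      · have := measurableSet_coord (𝓐 := 𝓐) (s := Ici (n - 1 + J)) (i := n + J - 1)
          (by simp; omega) {ξ (n + J - 1)} (MeasurableSet.of_discrete)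
        convert this using 1
        ext ω
        simp [shift_iterate]
  have hpow : ∀ (ξ : ℕ → 𝓐) i, P.real (cyl ξ (i * J)) ≤ (1 - δ / 2) ^ i := by
    intro ξ i
    induction i with
    | zero => simp [measureReal_le_one]
    | succ i ih =>
      rw [add_mul, one_mul, pow_succ']
      exact (step ξ _).trans (mul_le_mul_of_nonneg_left ih (by linarith))
  obtain ⟨r', hr0, hr1, hr'⟩ := pow_div_bound (1 - δ / 2) (by linarith) (by linarith) J hJ1
  refine ⟨(1 - δ / 2)⁻¹, r', (one_le_inv₀ (by linarith)).2 (by linarith), hr0, hr1, ?_⟩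
  intro ξ n
  refine le_trans ?_ ((hpow ξ (n / J)).trans (hr' n))
  refine measureReal_mono ?_
  intro ω hω i hi
  exact hω i (hi.trans_le (Nat.div_mul_le_self n J))
end symb


/-- the word read from a sequence -/
def wordMap {𝓐 : Type*} (n : ℕ) (ω : ℕ → 𝓐) : Fin n → 𝓐 := fun i => ω i

lemma wordMap_pre {𝓐 : Type*} (n : ℕ) (ξ : ℕ → 𝓐) :
    wordMap n ⁻¹' {wordMap n ξ} = cyl ξ n := by
  ext ω
  simp only [mem_preimage, mem_singleton_iff, wordMap, cyl, mem_ofPred_eq, funext_iff]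
  exact ⟨fun h i hi => h ⟨i, hi⟩, fun h i => h i i.2⟩

lemma wordMap_surj {𝓐 : Type*} [Nonempty 𝓐] (n : ℕ) (w : Fin n → 𝓐) :
    ∃ ξ : ℕ → 𝓐, wordMap n ξ = w := by
  classical
  refine ⟨fun i => if h : i < n then w ⟨i, h⟩ else Classical.arbitrary 𝓐, ?_⟩
  ext i
  simp [wordMap]

/-- self-matching set -/
def selfMatch (𝓐 : Type*) (k n : ℕ) : Set (ℕ → 𝓐) := {ω | ∀ i < n, ω (k + i) = ω i}

section symb
variable {𝓐 : Type*} [MeasurableSpace 𝓐] [DiscreteMeasurableSpace 𝓐] [Countable 𝓐] [Nontrivial 𝓐]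
variable (P : Measure (ℕ → 𝓐)) [IsProbabilityMeasure P]

lemma tsum_word (n : ℕ) (B : Set (ℕ → 𝓐)) (hB : MeasurableSet B) :
    ∑' w : Fin n → 𝓐, P (wordMap n ⁻¹' {w} ∩ B) = P B := by
  have hm : ∀ w : Fin n → 𝓐, MeasurableSet (wordMap n ⁻¹' {w}) := by
    intro w
    obtain ⟨ξ, rfl⟩ := wordMap_surj n w
    rw [wordMap_pre]; exact measurableSet_cyl ξ n
  rw [← measure_iUnion]
  · congr 1
    ext ω; simp
  · intro w v hwv
    rw [Function.onFun, Set.disjoint_left]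
    rintro ω ⟨h1, _⟩ ⟨h2, _⟩
    exact hwv (h1.symm.trans h2)
  · exact fun w => (hm w).inter hB

lemma measurableSet_selfMatch (k n : ℕ) : MeasurableSet (selfMatch 𝓐 k n) := by
  have : selfMatch 𝓐 k n = ⋂ i, ⋂ (_ : i < n), {ω : ℕ → 𝓐 | ω (k + i) = ω i} := by
    ext; simp [selfMatch]
  rw [this]
  exact MeasurableSet.iInter fun i => MeasurableSet.iInter fun _ =>
    measurableSet_eq_fun (measurable_pi_apply _) (measurable_pi_apply _)

lemma selfMatch_far (hinv : MeasurePreserving (shift 𝓐) P P) (β : ℝ) (hβ : 0 < β)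
    (hφ : ∀ n : ℕ, 1 ≤ n → phiMix 𝓐 P n ≤ β⁻¹ * Real.exp (-β * n))
    (B : ℝ) (j k : ℕ) (hj : 1 ≤ j) (hk : 2 * j ≤ k) (hB : ∀ ξ : ℕ → 𝓐, P.real (cyl ξ j) ≤ B) :
    P.real (selfMatch 𝓐 k j) ≤ B + β⁻¹ * Real.exp (-β * j) := by
  have hφ0 : 0 ≤ β⁻¹ * Real.exp (-β * j) := by positivity
  have hB0 : 0 ≤ B := by
    obtain ⟨a⟩ : Nonempty 𝓐 := inferInstance
    exact measureReal_nonneg.trans (hB fun _ => a)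
  have key : P (selfMatch 𝓐 k j) ≤ ENNReal.ofReal (B + β⁻¹ * Real.exp (-β * j)) := by
    rw [← tsum_word P j _ (measurableSet_selfMatch k j)]
    calc ∑' w : Fin j → 𝓐, P (wordMap j ⁻¹' {w} ∩ selfMatch 𝓐 k j)
        ≤ ∑' w : Fin j → 𝓐, ENNReal.ofReal (B + β⁻¹ * Real.exp (-β * j)) *
            P (wordMap j ⁻¹' {w} ∩ univ) := by
          refine ENNReal.tsum_le_tsum fun w => ?_
          obtain ⟨ξ, rfl⟩ := wordMap_surj j w
          rw [wordMap_pre, inter_univ]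
          have hs : cyl ξ j ∩ selfMatch 𝓐 k j ⊆ cyl ξ j ∩ (shift 𝓐)^[k] ⁻¹' cyl ξ j := by
            rintro ω ⟨h1, h2⟩
            refine ⟨h1, ?_⟩
            rw [pre_cyl]
            intro i hi
            rw [h2 i hi, h1 i hi]
          have h1 := (abs_le.1 (mix_of_phi P β hφ (j - 1) j hj (cyl ξ j)
            ((shift 𝓐)^[k] ⁻¹' cyl ξ j)
            (measurableSet_pre_cyl ξ j 0 _ (fun i hi => by simp; omega))
            (measurableSet_pre_cyl ξ j k _ (fun i hi => by simp; omega)))).2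
          rw [(hinv.iterate k).measureReal_preimage (measurableSet_cyl ξ j).nullMeasurableSet] at h1
          have h2 : P.real (cyl ξ j ∩ selfMatch 𝓐 k j) ≤
              (B + β⁻¹ * Real.exp (-β * j)) * P.real (cyl ξ j) := by
            have := measureReal_mono (μ := P) hs
            have h3 := mul_le_mul_of_nonneg_left (hB ξ) (measureReal_nonneg (μ := P) (s := cyl ξ j))
            nlinarith
          rw [← ofReal_measureReal (μ := P) (s := cyl ξ j ∩ selfMatch 𝓐 k j),
            ← ofReal_measureReal (μ := P) (s := cyl ξ j),
            ← ENNReal.ofReal_mul (by positivity)]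
          exact ENNReal.ofReal_le_ofReal h2
      _ = _ := by
          rw [ENNReal.tsum_mul_left, tsum_word P j univ MeasurableSet.univ, measure_univ, mul_one]
  exact ENNReal.toReal_le_of_le_ofReal (by positivity) key

lemma selfMatch_mult (k n t j : ℕ) (h : t * k + j ≤ n + k) : selfMatch 𝓐 k n ⊆ selfMatch 𝓐 (t * k) j := by
  intro ω hω i hi
  induction t with
  | zero => simp
  | succ t ih =>
    rw [add_mul, one_mul] at h ⊢
    rw [show t * k + k + i = k + (t * k + i) by ring, hω _ (by omega)]
    exact ih (by omega)

lemma selfMatch_decay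
    (hinv : MeasurePreserving (shift 𝓐) P P)
    (hpos : ∀ a : 𝓐, 0 < P {ω | ω 0 = a}) (β : ℝ) (hβ : 0 < β)
    (hφ : ∀ n : ℕ, 1 ≤ n → phiMix 𝓐 P n ≤ β⁻¹ * Real.exp (-β * n)) :
    ∃ C r : ℝ, 1 ≤ C ∧ 0 < r ∧ r < 1 ∧ (∀ (ξ : ℕ → 𝓐) n, P.real (cyl ξ n) ≤ C * r ^ n) ∧
      ∀ k n, 1 ≤ k → P.real (selfMatch 𝓐 k n) ≤ C * r ^ n := by
  obtain ⟨C, r, hC, hr0, hr1, hd⟩ := cyl_decay P hinv hpos β hβ hφ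
  set r2 := max r (Real.exp (-β)) with hr2
  have hr20 : 0 < r2 := lt_max_of_lt_left hr0
  have hr21 : r2 < 1 := max_lt hr1 (Real.exp_lt_one_iff.2 (by linarith))
  obtain ⟨r', hr'0, hr'1, hr'⟩ := pow_div_bound r2 hr20 hr21 4 (by norm_num)
  have hβ' : 0 < β⁻¹ := by positivity
  set D := C + β⁻¹ with hD
  have hD1 : 1 ≤ D := by linarith
  have hinv2 : 1 ≤ r2⁻¹ := (one_le_inv₀ hr20).2 hr21.le
  have hq : ∀ n : ℕ, D * r2 ^ (n / 4) ≤ D * r2⁻¹ * r' ^ n := fun n => by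
    rw [mul_assoc]; exact mul_le_mul_of_nonneg_left (hr' n) (by linarith)
  refine ⟨D * r2⁻¹, r', by nlinarith, hr'0, hr'1, ?_, ?_⟩
  · intro ξ n
    refine ((hd ξ n).trans ?_).trans (hq n)
    refine mul_le_mul (by linarith) ?_ (by positivity) (by linarith)
    calc r ^ n ≤ r ^ (n / 4) := pow_le_pow_of_le_one hr0.le hr1.le (Nat.div_le_self _ _)
      _ ≤ _ := pow_le_pow_left₀ hr0.le (le_max_left _ _) _
  · intro k n hk
    refine le_trans ?_ (hq n)
    set j := n / 4 with hj
    rcases Nat.eq_zero_or_pos j with h | h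
    · rw [h, pow_zero, mul_one]; exact measureReal_le_one.trans hD1
    · set t := (2 * j - 1) / k + 1 with ht
      have h1 : 2 * j ≤ t * k := by
        have := Nat.lt_div_mul_add (a := 2 * j - 1) (b := k) (by omega)
        rw [ht, add_mul, one_mul]; omega
      have h2 : t * k + j ≤ n + k := by
        have := Nat.div_mul_le_self (2 * j - 1) k
        rw [ht, add_mul, one_mul]; omega
      refine (measureReal_mono (selfMatch_mult k n t j h2)).trans ?_
      refine (selfMatch_far P hinv β hβ hφ (C * r ^ j) j _ h h1 (fun ξ => hd ξ j)).trans ?_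
      have e1 : r ^ j ≤ r2 ^ j := pow_le_pow_left₀ hr0.le (le_max_left _ _) _
      have e2 : Real.exp (-β * j) ≤ r2 ^ j := by
        rw [mul_comm, Real.exp_nat_mul]
        exact pow_le_pow_left₀ (Real.exp_pos _).le (le_max_right _ _) _
      rw [hD, add_mul]
      gcongr
end symb


lemma markov_word {Ω' W : Type*} [MeasurableSpace Ω'] [Countable W] (μ : Measure Ω') (X : Ω' → W)
    (ν : W → ENNReal) (c : ENNReal) :
    μ {ω | μ (X ⁻¹' {X ω}) ≤ c * ν (X ω)} ≤ c * ∑' w, ν w := by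
  set S := {ω | μ (X ⁻¹' {X ω}) ≤ c * ν (X ω)} with hS
  have h1 : S ⊆ ⋃ w, S ∩ X ⁻¹' {w} := by
    intro ω hω; simp [hω]
  refine (measure_mono h1).trans ((measure_iUnion_le _).trans ?_)
  rw [← ENNReal.tsum_mul_left]
  refine ENNReal.tsum_le_tsum fun w => ?_
  rcases (S ∩ X ⁻¹' {w}).eq_empty_or_nonempty with h | ⟨ω, hω, hw⟩
  · rw [h]; simp
  · refine (measure_mono inter_subset_right).trans ?_
    have hw' : X ω = w := hw
    have : μ (X ⁻¹' {X ω}) ≤ c * ν (X ω) := hω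
    rwa [hw'] at this

lemma bc_real {Ω' : Type*} [MeasurableSpace Ω'] (μ : Measure Ω') (E : ℕ → Set Ω') (b : ℕ → ℝ)
    (hb0 : ∀ n, 0 ≤ b n) (hb : Summable b) (h : ∀ᶠ n in atTop, μ (E n) ≤ ENNReal.ofReal (b n)) :
    ∀ᵐ ω ∂μ, ∀ᶠ n in atTop, ω ∉ E n := by
  obtain ⟨N, hN⟩ := eventually_atTop.1 h
  have h1 : ∑' n, μ (E (n + N)) ≠ ⊤ := by
    have hb' : Summable fun n => b (n + N) := (summable_nat_add_iff N).2 hb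
    refine ne_top_of_le_ne_top ?_ (ENNReal.tsum_le_tsum fun n => hN (n + N) (by omega))
    rw [← ENNReal.ofReal_tsum_of_nonneg (fun n => hb0 _) hb']
    exact ENNReal.ofReal_ne_top
  filter_upwards [ae_eventually_notMem h1] with ω hω
  obtain ⟨N', hN'⟩ := eventually_atTop.1 hω
  refine eventually_atTop.2 ⟨N' + N, fun n hn => ?_⟩
  have := hN' (n - N) (by omega)
  rwa [Nat.sub_add_cancel (by omega)] at this

section symb
variable {𝓐 : Type*} [MeasurableSpace 𝓐] [DiscreteMeasurableSpace 𝓐] [Countable 𝓐] [Nontrivial 𝓐]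
variable (P : Measure (ℕ → 𝓐)) [IsProbabilityMeasure P]

lemma measurableSet_coord_eq (i : ℕ) (a : 𝓐) : MeasurableSet {ω : ℕ → 𝓐 | ω i = a} :=
  coordAlg_le univ _ (measurableSet_coord (mem_univ i) {a} MeasurableSet.of_discrete)

lemma coord_stat (hinv : MeasurePreserving (shift 𝓐) P P) (i : ℕ) (a : 𝓐) :
    P {ω | ω i = a} = P {ω | ω 0 = a} := by
  rw [← (hinv.iterate i).measure_preimage (measurableSet_coord_eq 0 a).nullMeasurableSet]
  congr 1
  ext ω
  simp [shift_iterate]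

lemma tsum_prod_word (n : ℕ) : ∑' w : Fin n → 𝓐, ∏ i, P {ω | ω 0 = w i} = 1 := by
  have hm : Measurable fun ω : ℕ → 𝓐 => ω 0 := measurable_pi_apply 0
  set Q := P.map fun ω : ℕ → 𝓐 => ω 0 with hQ
  have : IsProbabilityMeasure Q := Measure.isProbabilityMeasure_map hm.aemeasurable
  have h1 : ∀ w : Fin n → 𝓐, ∏ i, P {ω | ω 0 = w i} = (Measure.pi fun _ : Fin n => Q) {w} := by
    intro w
    rw [Measure.pi_singleton]
    refine Finset.prod_congr rfl fun i _ => ?_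
    rw [hQ, Measure.map_apply hm MeasurableSet.of_discrete]
    rfl
  simp_rw [h1]
  rw [← measure_iUnion]
  · rw [iUnion_of_singleton, measure_univ]
  · intro a b hab
    simpa [Function.onFun] using hab
  · exact fun w => measurableSet_singleton w

lemma entropy_tail (hinv : MeasurePreserving (shift 𝓐) P P)
    (hpos : ∀ a : 𝓐, 0 < P {ω | ω 0 = a})
    (hent : Summable fun a : 𝓐 =>
      -((P {ω | ω 0 = a}).toReal * Real.log (P {ω | ω 0 = a}).toReal)) :
    ∃ H : ℝ, 0 ≤ H ∧ ∀ (K : ℝ) (i : ℕ), 0 < K →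
      P {ξ | P.real {ω | ω 0 = ξ i} < Real.exp (-K)} ≤ ENNReal.ofReal (H / K) := by
  have hle1 : ∀ a : 𝓐, P.real {ω | ω 0 = a} ≤ 1 := fun a => measureReal_le_one
  have hnn : ∀ a : 𝓐, 0 ≤ -((P {ω | ω 0 = a}).toReal * Real.log (P {ω | ω 0 = a}).toReal) := by
    intro a
    have h1 : Real.log (P.real {ω | ω 0 = a}) ≤ 0 :=
      Real.log_nonpos measureReal_nonneg (hle1 a)
    have h2 : 0 ≤ P.real {ω | ω 0 = a} := measureReal_nonneg
    have : P.real {ω | ω 0 = a} * Real.log (P.real {ω | ω 0 = a}) ≤ 0 :=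
      mul_nonpos_of_nonneg_of_nonpos h2 h1
    simp only [Measure.real] at this
    linarith
  refine ⟨∑' a : 𝓐, -((P {ω | ω 0 = a}).toReal * Real.log (P {ω | ω 0 = a}).toReal),
    tsum_nonneg hnn, fun K i hK => ?_⟩
  set S := {ξ : ℕ → 𝓐 | P.real {ω | ω 0 = ξ i} < Real.exp (-K)} with hS
  have h1 : S ⊆ ⋃ a, S ∩ {ω | ω i = a} := by
    intro ω hω; simp [hω]
  refine (measure_mono h1).trans ((measure_iUnion_le _).trans ?_)
  rw [← tsum_div_const, ENNReal.ofReal_tsum_of_nonneg (fun a => div_nonneg (hnn a) hK.le)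
    (hent.div_const K)]
  refine ENNReal.tsum_le_tsum fun a => ?_
  rcases (S ∩ {ω | ω i = a}).eq_empty_or_nonempty with h | ⟨ω, hω, hw⟩
  · rw [h]; simp
  · refine (measure_mono inter_subset_right).trans ?_
    have hw' : ω i = a := hw
    have h2 : P.real {ω' | ω' 0 = ω i} < Real.exp (-K) := hω
    rw [hw'] at h2
    rw [coord_stat P hinv i a]
    refine (ofReal_measureReal (μ := P) (s := {ω | ω 0 = a})).symm.le.trans ?_
    refine ENNReal.ofReal_le_ofReal ?_
    have hp : 0 < P.real {ω | ω 0 = a} := ENNReal.toReal_pos (hpos a).ne' (measure_ne_top _ _)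
    have h3 := (Real.log_lt_iff_lt_exp hp).2 h2
    rw [le_div_iff₀ hK]
    have h4 := mul_lt_mul_of_pos_left h3 hp
    simp only [Measure.real] at h4 ⊢
    linarith

lemma ae_lower (hinv : MeasurePreserving (shift 𝓐) P P)
    (hpos : ∀ a : 𝓐, 0 < P {ω | ω 0 = a})
    (hent : Summable fun a : 𝓐 =>
      -((P {ω | ω 0 = a}).toReal * Real.log (P {ω | ω 0 = a}).toReal))
    (M : ℕ → ℕ) (hM : ∀ᶠ n in atTop, n ≤ 2 * M n ∧ M n ≤ 2 * n) :
    ∀ᵐ ξ ∂P, ∀ᶠ n : ℕ in atTop, Real.exp (-((n : ℝ) + 2 * n ^ 4)) ≤ P.real (cyl ξ (M n)) := by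
  obtain ⟨H, hH0, hH⟩ := entropy_tail P hinv hpos hent
  have A1 : ∀ᵐ ξ ∂P, ∀ᶠ n in atTop, ξ ∉ {ξ : ℕ → 𝓐 | P (wordMap (M n) ⁻¹' {wordMap (M n) ξ}) ≤
      ENNReal.ofReal (Real.exp (-(n : ℝ))) *
        (fun w : Fin (M n) → 𝓐 => ∏ i, P {ω | ω 0 = w i}) (wordMap (M n) ξ)} := by
    refine bc_real P _ (fun n => Real.exp (-(n : ℝ))) (fun n => (Real.exp_pos _).le)
      Real.summable_exp_neg_nat (Eventually.of_forall fun n => ?_)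
    refine (markov_word P (wordMap (M n)) (fun w : Fin (M n) → 𝓐 => ∏ i, P {ω | ω 0 = w i}) _).trans ?_
    rw [tsum_prod_word P, mul_one]
  have A2 : ∀ᵐ ξ ∂P, ∀ᶠ n in atTop, ξ ∉ ⋃ i ∈ Finset.range (2 * n),
      {ξ : ℕ → 𝓐 | P.real {ω | ω 0 = ξ i} < Real.exp (-(n : ℝ) ^ 3)} := by
    refine bc_real P _ (fun n => 2 * H * (1 / (n : ℝ) ^ 2)) (fun n => by positivity)
      ((Real.summable_one_div_nat_pow.2 (by norm_num)).mul_left _) ?_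
    filter_upwards [eventually_ge_atTop 1] with n hn
    have hn' : (0 : ℝ) < n := by exact_mod_cast hn
    refine (measure_biUnion_finset_le _ _).trans ?_
    refine (Finset.sum_le_sum fun i _ => hH ((n : ℝ) ^ 3) i (by positivity)).trans ?_
    rw [Finset.sum_const, Finset.card_range, nsmul_eq_mul, ← ENNReal.ofReal_natCast,
      ← ENNReal.ofReal_mul (by positivity)]
    refine ENNReal.ofReal_le_ofReal (le_of_eq ?_)
    push_cast
    field_simp
  filter_upwards [A1, A2] with ξ h1 h2
  filter_upwards [h1, h2, hM] with n h1 h2 hM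
  simp only [mem_ofPred_eq, not_le, wordMap_pre] at h1
  simp only [mem_iUnion, not_exists, mem_ofPred_eq, not_lt, Finset.mem_range] at h2
  have h3 : Real.exp (-(n : ℝ)) * ∏ i : Fin (M n), P.real {ω | ω 0 = ξ i} ≤ P.real (cyl ξ (M n)) := by
    have := ENNReal.toReal_mono (measure_ne_top _ _) h1.le
    rw [ENNReal.toReal_mul, ENNReal.toReal_ofReal (Real.exp_pos _).le, ENNReal.toReal_prod] at this
    exact this
  refine le_trans ?_ h3
  have h4 : ∏ i : Fin (M n), Real.exp (-(n : ℝ) ^ 3) ≤ ∏ i : Fin (M n), P.real {ω | ω 0 = ξ i} :=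
    Finset.prod_le_prod (fun _ _ => (Real.exp_pos _).le) fun i _ => h2 i (by have := i.2; omega)
  refine le_trans ?_ (mul_le_mul_of_nonneg_left h4 (Real.exp_pos _).le)
  rw [Finset.prod_const, Finset.card_univ, Fintype.card_fin, ← Real.exp_nat_mul, ← Real.exp_add]
  refine Real.exp_le_exp.2 ?_
  have : (M n : ℝ) ≤ 2 * n := by exact_mod_cast hM.2
  have h5 : (M n : ℝ) * (n : ℝ) ^ 3 ≤ 2 * n * (n : ℝ) ^ 3 :=
    mul_le_mul_of_nonneg_right this (by positivity)
  nlinarith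

lemma ae_return (C r : ℝ) (hC : 1 ≤ C) (hr0 : 0 < r) (hr1 : r < 1)
    (hself : ∀ k n, 1 ≤ k → P.real (selfMatch 𝓐 k n) ≤ C * r ^ n)
    (M : ℕ → ℕ) (hM : ∀ᶠ n in atTop, n ≤ 2 * M n ∧ M n ≤ 2 * n) :
    ∀ᵐ ξ ∂P, ∀ᶠ n : ℕ in atTop, ∀ k, 1 ≤ k → k ≤ n ^ 7 →
      P.real (cyl ξ (M n) ∩ (shift 𝓐)^[k] ⁻¹' cyl ξ (M n)) ≤
        ((n : ℝ) ^ 20)⁻¹ * P.real (cyl ξ (M n)) := by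
  have A : ∀ᵐ ξ ∂P, ∀ᶠ n in atTop, ξ ∉ ⋃ k ∈ Finset.Icc 1 (n ^ 7),
      {ξ : ℕ → 𝓐 | P (wordMap (M n) ⁻¹' {wordMap (M n) ξ}) ≤
      ENNReal.ofReal ((n : ℝ) ^ 20) *
        (fun w : Fin (M n) → 𝓐 => P (wordMap (M n) ⁻¹' {w} ∩
          (shift 𝓐)^[k] ⁻¹' (wordMap (M n) ⁻¹' {w}))) (wordMap (M n) ξ)} := by
    have hs1 : Real.sqrt r < 1 := by
      rw [Real.sqrt_lt' one_pos]; simpa using hr1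
    refine bc_real P _ (fun n => C * ((n : ℝ) ^ 27 * Real.sqrt r ^ n)) (fun n => by positivity)
      ((summable_pow_mul_geometric_of_norm_lt_one 27
        (by rw [Real.norm_of_nonneg (Real.sqrt_nonneg r)]; exact hs1)).mul_left C) ?_
    filter_upwards [hM] with n hM
    refine (measure_biUnion_finset_le _ _).trans ?_
    have hk : ∀ k ∈ Finset.Icc 1 (n ^ 7), P {ξ : ℕ → 𝓐 | P (wordMap (M n) ⁻¹' {wordMap (M n) ξ}) ≤
      ENNReal.ofReal ((n : ℝ) ^ 20) *
        (fun w : Fin (M n) → 𝓐 => P (wordMap (M n) ⁻¹' {w} ∩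
          (shift 𝓐)^[k] ⁻¹' (wordMap (M n) ⁻¹' {w}))) (wordMap (M n) ξ)} ≤
        ENNReal.ofReal ((n : ℝ) ^ 20 * (C * Real.sqrt r ^ n)) := by
      intro k hk
      rw [Finset.mem_Icc] at hk
      refine (markov_word P (wordMap (M n)) (fun w : Fin (M n) → 𝓐 => P (wordMap (M n) ⁻¹' {w} ∩
          (shift 𝓐)^[k] ⁻¹' (wordMap (M n) ⁻¹' {w}))) _).trans ?_
      rw [ENNReal.ofReal_mul (by positivity)]
      refine mul_le_mul_right ?_ _
      calc ∑' w : Fin (M n) → 𝓐, P (wordMap (M n) ⁻¹' {w} ∩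
            (shift 𝓐)^[k] ⁻¹' (wordMap (M n) ⁻¹' {w}))
          ≤ ∑' w : Fin (M n) → 𝓐, P (wordMap (M n) ⁻¹' {w} ∩ selfMatch 𝓐 k (M n)) := by
            refine ENNReal.tsum_le_tsum fun w => measure_mono ?_
            rintro ω ⟨h1, h2⟩
            refine ⟨h1, fun i hi => ?_⟩
            have h1' : wordMap (M n) ω = w := h1
            have h2' : wordMap (M n) ((shift 𝓐)^[k] ω) = w := h2
            have := congrFun (h2'.trans h1'.symm) ⟨i, hi⟩
            simpa [wordMap, shift_iterate] using this
        _ = P (selfMatch 𝓐 k (M n)) := tsum_word P _ _ (measurableSet_selfMatch _ _)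
        _ = ENNReal.ofReal (P.real (selfMatch 𝓐 k (M n))) := by rw [ofReal_measureReal]
        _ ≤ _ := by
            refine ENNReal.ofReal_le_ofReal ((hself k _ hk.1).trans ?_)
            refine mul_le_mul_of_nonneg_left ?_ (by linarith)
            calc r ^ (M n) = Real.sqrt r ^ (2 * M n) := by rw [pow_mul, Real.sq_sqrt hr0.le]
              _ ≤ _ := pow_le_pow_of_le_one (Real.sqrt_nonneg r) hs1.le hM.1
    refine (Finset.sum_le_sum hk).trans ?_
    rw [Finset.sum_const, Nat.card_Icc, nsmul_eq_mul, ← ENNReal.ofReal_natCast,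
      ← ENNReal.ofReal_mul (by positivity)]
    refine ENNReal.ofReal_le_ofReal (le_of_eq ?_)
    rw [Nat.add_sub_cancel]
    push_cast
    ring
  filter_upwards [A] with ξ h1
  filter_upwards [h1, eventually_ge_atTop 1] with n h1 hn k hk1 hk2
  simp only [mem_iUnion, not_exists, mem_ofPred_eq, not_le, Finset.mem_Icc, wordMap_pre] at h1
  have h2 := ENNReal.toReal_mono (measure_ne_top _ _) (h1 k ⟨hk1, hk2⟩).le
  rw [ENNReal.toReal_mul, ENNReal.toReal_ofReal (by positivity)] at h2
  have hn' : (0 : ℝ) < n := by exact_mod_cast hn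
  rw [inv_mul_eq_div, le_div_iff₀ (by positivity), mul_comm]
  exact h2

lemma ae_pair (hinv : MeasurePreserving (shift 𝓐) P P) (M M' : ℕ → ℕ) :
    ∀ᵐ z ∂(P.prod P), ∀ᶠ n : ℕ in atTop, ∀ k, k ≤ n ^ 7 →
      P.real (cyl z.1 (M n) ∩ (shift 𝓐)^[k] ⁻¹' cyl z.2 (M' n)) ≤
        (n : ℝ) ^ 10 * P.real (cyl z.1 (M n)) * P.real (cyl z.2 (M' n)) := by
  let X : (n : ℕ) → (ℕ → 𝓐) × (ℕ → 𝓐) → (Fin (M n) → 𝓐) × (Fin (M' n) → 𝓐) :=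
    fun n z => (wordMap (M n) z.1, wordMap (M' n) z.2)
  have hX : ∀ n z, X n ⁻¹' {X n z} = cyl z.1 (M n) ×ˢ cyl z.2 (M' n) := by
    intro n z
    rw [← wordMap_pre, ← wordMap_pre]
    ext y
    simp [X]
  have A : ∀ᵐ z ∂(P.prod P), ∀ᶠ n in atTop, z ∉ ⋃ k ∈ Finset.range (n ^ 7 + 1),
      {z : (ℕ → 𝓐) × (ℕ → 𝓐) | (P.prod P) (X n ⁻¹' {X n z}) ≤
      ENNReal.ofReal (((n : ℝ) ^ 10)⁻¹) *
        (fun w : (Fin (M n) → 𝓐) × (Fin (M' n) → 𝓐) => P (wordMap (M n) ⁻¹' {w.1} ∩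
          (shift 𝓐)^[k] ⁻¹' (wordMap (M' n) ⁻¹' {w.2}))) (X n z)} := by
    refine bc_real _ _ (fun n => 2 * (1 / (n : ℝ) ^ 3)) (fun n => by positivity)
      ((Real.summable_one_div_nat_pow.2 (by norm_num)).mul_left _) ?_
    filter_upwards [eventually_ge_atTop 1] with n hn
    have hn' : (1 : ℝ) ≤ n := by exact_mod_cast hn
    refine (measure_biUnion_finset_le _ _).trans ?_
    have hk : ∀ k ∈ Finset.range (n ^ 7 + 1), (P.prod P)
      {z : (ℕ → 𝓐) × (ℕ → 𝓐) | (P.prod P) (X n ⁻¹' {X n z}) ≤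
      ENNReal.ofReal (((n : ℝ) ^ 10)⁻¹) *
        (fun w : (Fin (M n) → 𝓐) × (Fin (M' n) → 𝓐) => P (wordMap (M n) ⁻¹' {w.1} ∩
          (shift 𝓐)^[k] ⁻¹' (wordMap (M' n) ⁻¹' {w.2}))) (X n z)} ≤
        ENNReal.ofReal (((n : ℝ) ^ 10)⁻¹) := by
      intro k _
      refine (markov_word (P.prod P) (X n) (fun w : (Fin (M n) → 𝓐) × (Fin (M' n) → 𝓐) =>
        P (wordMap (M n) ⁻¹' {w.1} ∩ (shift 𝓐)^[k] ⁻¹' (wordMap (M' n) ⁻¹' {w.2}))) _).trans (le_of_eq ?_)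
      have hm : ∀ v : Fin (M' n) → 𝓐, MeasurableSet (wordMap (M' n) ⁻¹' {v}) := by
        intro w
        obtain ⟨ξ, rfl⟩ := wordMap_surj _ w
        rw [wordMap_pre]; exact measurableSet_cyl ξ _
      have hTm : Measurable ((shift 𝓐)^[k]) := (hinv.iterate k).measurable
      rw [ENNReal.tsum_prod', ENNReal.tsum_comm]
      have e1 : ∀ v : Fin (M' n) → 𝓐, ∑' w : Fin (M n) → 𝓐, P (wordMap (M n) ⁻¹' {w} ∩
          (shift 𝓐)^[k] ⁻¹' (wordMap (M' n) ⁻¹' {v})) = P (wordMap (M' n) ⁻¹' {v} ∩ univ) := by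
        intro v
        rw [tsum_word P _ _ (hTm (hm v)),
          (hinv.iterate k).measure_preimage (hm v).nullMeasurableSet, inter_univ]
      simp_rw [e1]
      rw [tsum_word P _ _ MeasurableSet.univ, measure_univ, mul_one]
    refine (Finset.sum_le_sum hk).trans ?_
    rw [Finset.sum_const, Finset.card_range, nsmul_eq_mul, ← ENNReal.ofReal_natCast,
      ← ENNReal.ofReal_mul (by positivity)]
    refine ENNReal.ofReal_le_ofReal ?_
    push_cast
    have : (1 : ℝ) ≤ (n : ℝ) ^ 7 := one_le_pow₀ hn'
    rw [← div_eq_mul_inv, mul_one_div, div_le_div_iff₀ (by positivity) (by positivity)]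
    have h3 : (0 : ℝ) < (n : ℝ) ^ 3 := by positivity
    calc ((n : ℝ) ^ 7 + 1) * n ^ 3 ≤ ((n : ℝ) ^ 7 + (n : ℝ) ^ 7) * n ^ 3 := by gcongr
      _ = _ := by ring
  filter_upwards [A] with z h1
  filter_upwards [h1, eventually_ge_atTop 1] with n h1 hn k hk
  simp only [mem_iUnion, not_exists, mem_ofPred_eq, not_le, Finset.mem_range, hX] at h1
  have h2 := (h1 k (by omega)).le
  simp only [X, wordMap_pre, Measure.prod_prod] at h2
  have h3 := ENNReal.toReal_mono (ENNReal.mul_ne_top (measure_ne_top _ _) (measure_ne_top _ _)) h2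
  rw [ENNReal.toReal_mul, ENNReal.toReal_mul, ENNReal.toReal_ofReal (by positivity)] at h3
  have hn' : (0 : ℝ) < n := by exact_mod_cast hn
  rw [inv_mul_eq_div, div_le_iff₀ (by positivity)] at h3
  rw [mul_assoc, mul_comm]
  exact h3
end symb


section symb
variable {𝓐 : Type*} [MeasurableSpace 𝓐] [DiscreteMeasurableSpace 𝓐] [Countable 𝓐] [Nontrivial 𝓐]
variable (P : Measure (ℕ → 𝓐)) [IsProbabilityMeasure P]

lemma disjoint_cyl (ξ η : ℕ → 𝓐) (n m : ℕ) (a : ℝ) (hp : 0 < P.real (cyl ξ n))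
    (hq : 0 < P.real (cyl η m)) (hap : a * P.real (cyl ξ n) < 1) (haq : a * P.real (cyl η m) < 1)
    (h : P.real (cyl ξ n ∩ cyl η m) ≤ a * P.real (cyl ξ n) * P.real (cyl η m)) :
    Disjoint (cyl ξ n) (cyl η m) := by
  rw [Set.disjoint_left]
  intro ω h1 h2
  rcases le_total n m with hnm | hnm
  · have e : cyl ξ n ∩ cyl η m = cyl η m := by
      refine inter_eq_right.2 fun x hx i hi => ?_
      rw [hx i (by omega), ← h2 i (by omega), h1 i hi]
    rw [e] at h
    have := mul_lt_mul_of_pos_right hap hq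
    linarith
  · have e : cyl ξ n ∩ cyl η m = cyl ξ n := by
      refine inter_eq_left.2 fun x hx i hi => ?_
      rw [hx i (by omega), ← h1 i (by omega), h2 i hi]
    rw [e] at h
    have := mul_lt_mul_of_pos_right haq hp
    nlinarith

lemma det_step (hinv : MeasurePreserving (shift 𝓐) P P) (β : ℝ) (hβ : 0 < β)
    (hφ : ∀ n : ℕ, 1 ≤ n → phiMix 𝓐 P n ≤ β⁻¹ * Real.exp (-β * n))
    (ξ η : ℕ → 𝓐) (n m : ℕ) (hn : 2 ≤ n) (hm : m ≤ 2 * n) (D : ℝ)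
    (hp : 0 < P.real (cyl ξ n)) (hpD : P.real (cyl ξ n) ≤ D) (hqD : P.real (cyl η m) ≤ D)
    (hD : (n : ℝ) ^ 10 * D < 1)
    (hq : Real.exp (-((n : ℝ) + 2 * n ^ 4)) ≤ P.real (cyl η m))
    (hβn : 4 ≤ β * n) (hx : β⁻¹ * Real.exp (-(n : ℝ)) ≤ 1 / 2)
    (hξξ : ∀ k, 1 ≤ k → k ≤ n ^ 7 →
      P.real (cyl ξ n ∩ (shift 𝓐)^[k] ⁻¹' cyl ξ n) ≤ ((n : ℝ) ^ 20)⁻¹ * P.real (cyl ξ n))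
    (hηη : ∀ k, 1 ≤ k → k ≤ n ^ 7 →
      P.real (cyl η m ∩ (shift 𝓐)^[k] ⁻¹' cyl η m) ≤ ((n : ℝ) ^ 20)⁻¹ * P.real (cyl η m))
    (hξη : ∀ k, k ≤ n ^ 7 → P.real (cyl ξ n ∩ (shift 𝓐)^[k] ⁻¹' cyl η m) ≤
        (n : ℝ) ^ 10 * P.real (cyl ξ n) * P.real (cyl η m))
    (hηξ : ∀ k, k ≤ n ^ 7 → P.real (cyl η m ∩ (shift 𝓐)^[k] ⁻¹' cyl ξ n) ≤
        (n : ℝ) ^ 10 * P.real (cyl η m) * P.real (cyl ξ n)) :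
    dTV (P.map (numVisits (shift 𝓐) (cyl ξ n) (cyl η m)))
      (geoMeasure (P.real (cyl η m) / (P.real (cyl η m) + P.real (cyl ξ n)))) ≤
      2 * (16 * ((n : ℝ) ^ 6)⁻¹ + 100 * ((n : ℝ) ^ 24 * D) +
        40 * β⁻¹ * ((n : ℝ) ^ 7 * Real.exp (-(n : ℝ)))) := by
  have hn' : (2 : ℝ) ≤ n := by exact_mod_cast hn
  have hq0 : 0 < P.real (cyl η m) := (Real.exp_pos _).trans_le hq
  have hD0 : 0 < D := hp.trans_le hpD
  set g := 2 * n + n ^ 6 with hg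
  have hg7 : g ≤ n ^ 7 := by
    have h1 : n ^ 1 ≤ n ^ 5 := Nat.pow_le_pow_right (by omega) (by norm_num)
    rw [pow_one] at h1
    have h2 : 2 * n ^ 6 ≤ n ^ 7 := by
      rw [show n ^ 7 = n * n ^ 6 by ring]; exact Nat.mul_le_mul_right _ hn
    have h3 : 2 * n ^ 5 ≤ n ^ 6 := by
      rw [show n ^ 6 = n * n ^ 5 by ring]; exact Nat.mul_le_mul_right _ hn
    omega
  have hg1 : 1 ≤ g := by omega
  set φ := β⁻¹ * Real.exp (-β * (n ^ 6 : ℕ)) with hφdef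
  have hφ0 : 0 ≤ φ := by positivity
  have hφq : φ / P.real (cyl η m) ≤ β⁻¹ * Real.exp (-(n : ℝ)) := by
    rw [div_le_iff₀ hq0]
    refine le_trans ?_ (mul_le_mul_of_nonneg_left hq (by positivity))
    rw [hφdef, mul_assoc, ← Real.exp_add]
    refine mul_le_mul_of_nonneg_left (Real.exp_le_exp.2 ?_) (by positivity)
    push_cast
    have h1 : 4 * (n : ℝ) ^ 5 ≤ β * n * (n : ℝ) ^ 5 := by gcongr
    have h2 : (n : ℝ) ^ 1 ≤ (n : ℝ) ^ 5 := pow_le_pow_right₀ (by linarith) (by norm_num)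
    have h3 : (n : ℝ) ^ 4 ≤ (n : ℝ) ^ 5 := pow_le_pow_right₀ (by linarith) (by norm_num)
    have h4 : β * n * (n : ℝ) ^ 5 = β * (n : ℝ) ^ 6 := by ring
    linarith
  have hdis : Disjoint (cyl ξ n) (cyl η m) := by
    refine disjoint_cyl P ξ η n m ((n : ℝ) ^ 10) hp hq0 (lt_of_le_of_lt ?_ hD)
      (lt_of_le_of_lt ?_ hD) (by simpa using hξη 0 (Nat.zero_le _)) <;> gcongr
  have key := main_det' P (shift 𝓐) hinv (cyl ξ n) (cyl η m) (measurableSet_cyl _ _)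
    (measurableSet_cyl _ _) hdis (fun s => coordAlg 𝓐 (Iic (s + 2 * n))) (fun t => coordAlg 𝓐 (Ici t))
    (fun i t h => measurableSet_pre_cyl _ _ _ _ fun k hk => by simp only [mem_Iic]; omega)
    (fun i t h => measurableSet_pre_cyl _ _ _ _ fun k hk => by simp only [mem_Iic]; omega)
    (fun i t h => measurableSet_pre_cyl _ _ _ _ fun k hk => by simp only [mem_Ici]; omega)
    (fun i t h => measurableSet_pre_cyl _ _ _ _ fun k hk => by simp only [mem_Ici]; omega)
    g hg1 φ hφ0
    (fun s Γ Δ hΓ hΔ => mix_of_phi P β hφ (s + 2 * n) (n ^ 6) (Nat.one_le_pow _ _ (by omega)) Γ Δ hΓ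
      (by rw [add_assoc]; exact hΔ)) hp hq0 (hφq.trans hx)
    ((n : ℝ) ^ 20)⁻¹ ((n : ℝ) ^ 10) (by positivity) (by positivity)
    (fun j h1 h2 => hξξ j h1 (h2.trans hg7)) (fun j h1 h2 => hηη j h1 (h2.trans hg7))
    (fun j _ h2 => hξη j (h2.trans hg7))
    (fun j _ h2 => (hηξ j (h2.trans hg7)).trans (le_of_eq (by ring)))
  refine key.trans ?_
  have hg' : (g : ℝ) ≤ (n : ℝ) ^ 7 := by exact_mod_cast hg7
  have hg0 : (0 : ℝ) ≤ g := by positivity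
  have hg2 : (g : ℝ) ^ 2 ≤ (n : ℝ) ^ 14 := by
    calc (g : ℝ) ^ 2 ≤ ((n : ℝ) ^ 7) ^ 2 := by gcongr
      _ = _ := by ring
  have e1 : 16 * (g : ℝ) ^ 2 * ((n : ℝ) ^ 20)⁻¹ ≤ 16 * ((n : ℝ) ^ 6)⁻¹ := by
    calc 16 * (g : ℝ) ^ 2 * ((n : ℝ) ^ 20)⁻¹ ≤ 16 * (n : ℝ) ^ 14 * ((n : ℝ) ^ 20)⁻¹ := by gcongr
      _ = _ := by field_simp
  have e2 : 25 * (g : ℝ) ^ 2 * (1 + (n : ℝ) ^ 10) * (P.real (cyl ξ n) + P.real (cyl η m)) ≤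
      100 * ((n : ℝ) ^ 24 * D) := by
    have : (1 : ℝ) ≤ (n : ℝ) ^ 10 := one_le_pow₀ (by linarith)
    calc 25 * (g : ℝ) ^ 2 * (1 + (n : ℝ) ^ 10) * (P.real (cyl ξ n) + P.real (cyl η m))
        ≤ 25 * (n : ℝ) ^ 14 * ((n : ℝ) ^ 10 + (n : ℝ) ^ 10) * (D + D) := by gcongr
      _ = _ := by ring
  have e3 : 40 * (g : ℝ) * (φ / P.real (cyl η m)) ≤
      40 * β⁻¹ * ((n : ℝ) ^ 7 * Real.exp (-(n : ℝ))) := by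
    calc 40 * (g : ℝ) * (φ / P.real (cyl η m)) ≤ 40 * (n : ℝ) ^ 7 * (β⁻¹ * Real.exp (-(n : ℝ))) := by
          gcongr
      _ = _ := by ring
  linarith

lemma ratio_part (hinv : MeasurePreserving (shift 𝓐) P P) (m : ℕ → ℕ) (ξ η : ℕ → 𝓐)
    (hp : ∀ᶠ n in atTop, 0 < P.real (cyl ξ n)) (hq : ∀ᶠ n in atTop, 0 < P.real (cyl η (m n)))
    (h : Tendsto (fun n => dTV (P.map (numVisits (shift 𝓐) (cyl ξ n) (cyl η (m n))))
      (geoMeasure (P.real (cyl η (m n)) / (P.real (cyl η (m n)) + P.real (cyl ξ n)))))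
        atTop (nhds 0)) (lam : ℝ)
    (hl : Tendsto (fun n => P.real (cyl ξ n) / P.real (cyl η (m n))) atTop (nhds lam)) :
    Tendsto (fun n => dTV (P.map (numVisits (shift 𝓐) (cyl ξ n) (cyl η (m n))))
      (geoMeasure (1 + lam)⁻¹)) atTop (nhds 0) := by
  have hl0 : 0 ≤ lam := ge_of_tendsto' hl fun n => by positivity
  have h1l : 0 < 1 + lam := by linarith
  set ρ : ℕ → ℝ := fun n => P.real (cyl η (m n)) / (P.real (cyl η (m n)) + P.real (cyl ξ n)) with hρ
  have hρt : Tendsto ρ atTop (nhds (1 + lam)⁻¹) := by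
    have h2 : Tendsto (fun n => (1 + P.real (cyl ξ n) / P.real (cyl η (m n)))⁻¹) atTop
        (nhds (1 + lam)⁻¹) := (hl.const_add 1).inv₀ h1l.ne'
    refine h2.congr' ?_
    filter_upwards [hq] with n hq
    simp only [hρ]
    field_simp
  have hbt : Tendsto (fun n => 2 * (|ρ n - (1 + lam)⁻¹| / ρ n)) atTop (nhds 0) := by
    have h2 : Tendsto (fun n => 2 * (|ρ n - (1 + lam)⁻¹| / ρ n)) atTop
        (nhds (2 * (|(1 + lam)⁻¹ - (1 + lam)⁻¹| / (1 + lam)⁻¹))) :=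
      ((hρt.sub_const _).abs.div hρt (by positivity)).const_mul 2
    simpa using h2
  have hsum := h.add hbt
  rw [add_zero] at hsum
  refine tendsto_of_tendsto_of_tendsto_of_le_of_le' tendsto_const_nhds hsum
    (Eventually.of_forall fun n => dTV_nonneg _ _) ?_
  filter_upwards [hp, hq] with n hp hq
  have hρ0 : 0 < ρ n := by simp only [hρ]; positivity
  have hρ1 : ρ n ≤ 1 := by
    simp only [hρ]; rw [div_le_one (by positivity)]; linarith
  have hi0 : 0 < (1 + lam)⁻¹ := by positivity
  have hi1 : (1 + lam)⁻¹ ≤ 1 := inv_le_one_of_one_le₀ (by linarith)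
  have := geo_prob (ρ n) hρ0 hρ1
  have := geo_prob _ hi0 hi1
  have : IsProbabilityMeasure (P.map (numVisits (shift 𝓐) (cyl ξ n) (cyl η (m n)))) :=
    Measure.isProbabilityMeasure_map (measurable_numVisits (shift 𝓐) hinv.measurable _ _
      (measurableSet_cyl _ _) (measurableSet_cyl _ _)).aemeasurable
  refine (dTV_triangle _ (geoMeasure (ρ n)) _).trans ?_
  exact add_le_add le_rfl (dTV_geo_geo _ _ hi0 hi1 hρ0 hρ1)
end symb

/-- Corollary 2.2: for `P×P`-a.e. pair `(ξ,η)`, the law of `Σ^{ξ,η}_{n,m(n)}` approaches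
the geometric distribution in total variation; in particular, if the ratio of cylinder
measures converges to `λ`, the law converges in total variation to `Geo((1+λ)⁻¹)`. -/
theorem geometric_law_ae_cylinders
    {𝓐 : Type*} [MeasurableSpace 𝓐] [DiscreteMeasurableSpace 𝓐] [Countable 𝓐] [Nontrivial 𝓐]
    (P : Measure (ℕ → 𝓐)) [IsProbabilityMeasure P]
    (hinv : MeasurePreserving (shift 𝓐) P P)
    (hpos : ∀ a : 𝓐, 0 < P {ω | ω 0 = a})
    (m : ℕ → ℕ) (hm1 : ∀ n, 1 ≤ m n)
    (hmo : Tendsto (fun n : ℕ => |(m n : ℝ) - (n : ℝ)| / (n : ℝ)) atTop (nhds 0))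
    (β : ℝ) (hβ : 0 < β)
    (hφ : ∀ n : ℕ, 1 ≤ n → phiMix 𝓐 P n ≤ β⁻¹ * Real.exp (-β * n))
    (hent : Summable fun a : 𝓐 =>
      -((P {ω | ω 0 = a}).toReal * Real.log (P {ω | ω 0 = a}).toReal)) :
    ∀ᵐ ξη ∂(P.prod P),
      Tendsto (fun n =>
          dTV (P.map (numVisits (shift 𝓐) (cyl ξη.1 n) (cyl ξη.2 (m n))))
            (geoMeasure ((P (cyl ξη.2 (m n))).toReal /
              ((P (cyl ξη.2 (m n))).toReal + (P (cyl ξη.1 n)).toReal))))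
        atTop (nhds 0)
      ∧ ∀ lam : ℝ,
          Tendsto (fun n => (P (cyl ξη.1 n)).toReal / (P (cyl ξη.2 (m n))).toReal)
            atTop (nhds lam) →
          Tendsto (fun n =>
              dTV (P.map (numVisits (shift 𝓐) (cyl ξη.1 n) (cyl ξη.2 (m n))))
                (geoMeasure (1 + lam)⁻¹))
            atTop (nhds 0) := by
  obtain ⟨C, r, hC, hr0, hr1, hd, hself⟩ := selfMatch_decay P hinv hpos β hβ hφ
  have hM1 : ∀ᶠ n : ℕ in atTop, n ≤ 2 * (id n) ∧ (id n) ≤ 2 * n :=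
    Eventually.of_forall fun n => ⟨by simp only [id]; omega, by simp only [id]; omega⟩
  have hM2 : ∀ᶠ n : ℕ in atTop, n ≤ 2 * m n ∧ m n ≤ 2 * n := by
    have h1 := hmo.eventually (gt_mem_nhds (show (0 : ℝ) < 1 / 2 by norm_num))
    filter_upwards [h1, eventually_ge_atTop 1] with n h hn
    have hn' : (0 : ℝ) < n := by exact_mod_cast hn
    rw [div_lt_iff₀ hn', abs_lt] at h
    constructor
    · have : (n : ℝ) ≤ 2 * m n := by linarith [h.1]
      exact_mod_cast this
    · have : (m n : ℝ) ≤ 2 * n := by linarith [h.2]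
      exact_mod_cast this
  have q1 : Measure.QuasiMeasurePreserving (Prod.fst : (ℕ → 𝓐) × (ℕ → 𝓐) → _) (P.prod P) P :=
    Measure.quasiMeasurePreserving_fst
  have q2 : Measure.QuasiMeasurePreserving (Prod.snd : (ℕ → 𝓐) × (ℕ → 𝓐) → _) (P.prod P) P :=
    Measure.quasiMeasurePreserving_snd
  have q3 : Measure.QuasiMeasurePreserving (Prod.swap : (ℕ → 𝓐) × (ℕ → 𝓐) → _)
      (P.prod P) (P.prod P) := Measure.measurePreserving_swap.quasiMeasurePreserving
  have hs0 := Real.sqrt_nonneg r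
  have hs1 : Real.sqrt r < 1 := by
    rw [Real.sqrt_lt' one_pos]; simpa using hr1
  have hdec : ∀ (ζ : ℕ → 𝓐) (n k : ℕ), n ≤ 2 * k → P.real (cyl ζ k) ≤ C * Real.sqrt r ^ n := by
    intro ζ n k h
    refine (hd ζ k).trans (mul_le_mul_of_nonneg_left ?_ (by linarith))
    calc r ^ k = Real.sqrt r ^ (2 * k) := by rw [pow_mul, Real.sq_sqrt hr0.le]
      _ ≤ _ := pow_le_pow_of_le_one hs0 hs1.le h
  have hpt : ∀ k : ℕ, Tendsto (fun n : ℕ => (n : ℝ) ^ k * (C * Real.sqrt r ^ n)) atTop (nhds 0) := by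
    intro k
    have := (tendsto_pow_const_mul_const_pow_of_abs_lt_one k
      (by rwa [abs_of_nonneg hs0] : |Real.sqrt r| < 1)).const_mul C
    rw [mul_zero] at this
    exact this.congr fun n => by ring
  have hexpt : ∀ k : ℕ, Tendsto (fun n : ℕ => (n : ℝ) ^ k * Real.exp (-(n : ℝ))) atTop (nhds 0) := by
    intro k
    have := tendsto_pow_const_mul_const_pow_of_abs_lt_one k
      (by rw [abs_of_pos (Real.exp_pos _)]; exact Real.exp_lt_one_iff.2 (by norm_num) :
        |Real.exp (-1)| < 1)
    refine this.congr fun n => ?_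
    rw [← Real.exp_nat_mul]; simp
  have hxt : Tendsto (fun n : ℕ => β⁻¹ * Real.exp (-(n : ℝ))) atTop (nhds 0) := by
    have := (hexpt 0).const_mul β⁻¹
    simpa using this
  have hβn : ∀ᶠ n : ℕ in atTop, 4 ≤ β * n :=
    (Tendsto.const_mul_atTop hβ tendsto_natCast_atTop_atTop).eventually_ge_atTop 4
  have hB : Tendsto (fun n : ℕ => 2 * (16 * ((n : ℝ) ^ 6)⁻¹ +
      100 * ((n : ℝ) ^ 24 * (C * Real.sqrt r ^ n)) +
        40 * β⁻¹ * ((n : ℝ) ^ 7 * Real.exp (-(n : ℝ))))) atTop (nhds 0) := by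
    have h1 : Tendsto (fun n : ℕ => ((n : ℝ) ^ 6)⁻¹) atTop (nhds 0) :=
      tendsto_inv_atTop_zero.comp
        ((tendsto_pow_atTop (by norm_num : (6 : ℕ) ≠ 0)).comp tendsto_natCast_atTop_atTop)
    have := ((((h1.const_mul 16).add ((hpt 24).const_mul 100)).add
      ((hexpt 7).const_mul (40 * β⁻¹))).const_mul 2)
    simpa using this
  filter_upwards [q1.ae (ae_lower P hinv hpos hent id hM1), q2.ae (ae_lower P hinv hpos hent m hM2),
    q1.ae (ae_return P C r hC hr0 hr1 hself id hM1), q2.ae (ae_return P C r hC hr0 hr1 hself m hM2),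
    ae_pair P hinv id m, q3.ae (ae_pair P hinv m id)] with z a1 a2 a3 a4 a5 a6
  have hp : ∀ᶠ n in atTop, 0 < P.real (cyl z.1 n) := a1.mono fun n h => (Real.exp_pos _).trans_le h
  have hq : ∀ᶠ n in atTop, 0 < P.real (cyl z.2 (m n)) :=
    a2.mono fun n h => (Real.exp_pos _).trans_le h
  have first : Tendsto (fun n => dTV (P.map (numVisits (shift 𝓐) (cyl z.1 n) (cyl z.2 (m n))))
      (geoMeasure (P.real (cyl z.2 (m n)) / (P.real (cyl z.2 (m n)) + P.real (cyl z.1 n)))))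
        atTop (nhds 0) := by
    refine tendsto_of_tendsto_of_tendsto_of_le_of_le' tendsto_const_nhds hB
      (Eventually.of_forall fun n => dTV_nonneg _ _) ?_
    filter_upwards [hp, a2, a3, a4, a5, a6, hM2, hβn, eventually_ge_atTop 2,
      hxt.eventually (ge_mem_nhds (show (0 : ℝ) < 1 / 2 by norm_num)),
      (hpt 10).eventually (gt_mem_nhds one_pos)] with n hp a2 a3 a4 a5 a6 hM2 hβn hn hx hD
    exact det_step P hinv β hβ hφ z.1 z.2 n (m n) hn hM2.2 _ hp (hdec _ _ _ (by omega))
      (hdec _ _ _ hM2.1) hD a2 hβn hx a3 a4 a5 a6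
  exact ⟨first, fun lam hl => ratio_part P hinv m z.1 z.2 hp hq first lam hl⟩
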